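/- arXiv:1706.01146 — 2 statements merged into one kernel-verified Lean document; each statement's English description precedes it below -/
import Mathlib

section
/- Let (Ω, μ) be a σ-finite measure space, let p ∈ [1, ∞), and let (T_t)_{t ∈ [0,∞)} be a positive and contractive C₀-semigroup on L^p(Ω, μ; ℝ). Suppose that for every t ≥ 0 there is a positive integral operator K_t on L^p with K_t f ≤ T_t f for all f ≥ 0, which is maximal in the sense that every positive integral operator K with K f ≤ T_t f for all f ≥ 0 satisfies K f ≤ K_t f for all f ≥ 0. Writing R_t := T_t − K_t, one has R_{s+t} f ≤ R_t (R_s f) for all s, t ≥ 0 and all f ∈ L^p with f ≥ 0. -/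
open MeasureTheory Filter
open scoped ENNReal NNReal

noncomputable section

/-- A bounded linear operator on `L^p` is positive if it maps a.e.-nonnegative functions
to a.e.-nonnegative functions. -/
def IsPositiveOp {Ω : Type*} [MeasurableSpace Ω] {μ : Measure Ω} {p : ℝ≥0∞} [Fact (1 ≤ p)]
    (T : Lp ℝ p μ →L[ℝ] Lp ℝ p μ) : Prop :=
  ∀ f : Lp ℝ p μ, 0 ≤ f → 0 ≤ T f

/-- A bounded linear operator on `L^p` is an integral operator if there is a
nonnegative measurable kernel `k : Ω × Ω → [0,∞)` such that for every `f ∈ L^p` the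
function `x ↦ k x y * f x` is integrable for a.e. `y` and
`(T f)(y) = ∫ k x y * f x dμ(x)` for a.e. `y`. -/
def IsIntegralOp {Ω : Type*} [MeasurableSpace Ω] {μ : Measure Ω} {p : ℝ≥0∞} [Fact (1 ≤ p)]
    (T : Lp ℝ p μ →L[ℝ] Lp ℝ p μ) : Prop :=
  ∃ k : Ω → Ω → ℝ, Measurable (Function.uncurry k) ∧ (∀ x y, 0 ≤ k x y) ∧
    ∀ f : Lp ℝ p μ,
      (∀ᵐ y ∂μ, Integrable (fun x => k x y * f x) μ) ∧
      (T f : Ω → ℝ) =ᵐ[μ] fun y => ∫ x, k x y * f x ∂μ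

open Set Topology

/-- A finite measure on a product that dominates another measure on measurable rectangles
dominates it everywhere. -/
theorem Measure.le_of_forall_prod_le {α β : Type*} [MeasurableSpace α] [MeasurableSpace β]
    {ν ν' : Measure (α × β)} [IsFiniteMeasure ν']
    (h : ∀ A B, MeasurableSet A → MeasurableSet B → ν (A ×ˢ B) ≤ ν' (A ×ˢ B)) : ν ≤ ν' := by
  classical
  set C : Set (Set (α × β)) :=
    image2 (fun A B => A ×ˢ B) {A | MeasurableSet A} {B | MeasurableSet B} with hC
  set c : Set (α × β) → ℝ≥0∞ := fun R => if R ∈ C then ν' R else ∞ with hc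
  have hcC : ∀ {R}, R ∈ C → c R = ν' R := fun hR => if_pos hR
  have hc0 : c ∅ = 0 := by
    rw [hcC ⟨∅, .empty, ∅, .empty, by simp⟩, measure_empty]
  set O : OuterMeasure (α × β) := OuterMeasure.ofFunction c hc0 with hO
  have hsplit : ∀ S : Set (α × β), MeasurableSet S → (∀ R ∈ C, R ∩ S ∈ C ∧ R \ S ∈ C) →
      MeasurableSet[O.caratheodory] S := by
    intro S hS hSC
    refine OuterMeasure.ofFunction_caratheodory fun R => ?_
    by_cases hR : R ∈ C
    · rw [hcC hR, hcC (hSC R hR).1, hcC (hSC R hR).2, measure_inter_add_sdiff R hS]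
    · simp [hc, hR]
  have hle : (Prod.instMeasurableSpace : MeasurableSpace (α × β)) ≤ O.caratheodory := by
    refine sup_le ?_ ?_
    · rintro _ ⟨A, hA, rfl⟩
      refine hsplit _ (measurable_fst hA) ?_
      rintro _ ⟨A', hA', B', hB', rfl⟩
      exact ⟨⟨A' ∩ A, hA'.inter hA, B', hB', by ext; simp; tauto⟩,
        ⟨A' \ A, hA'.diff hA, B', hB', by ext; simp; tauto⟩⟩
    · rintro _ ⟨B, hB, rfl⟩
      refine hsplit _ (measurable_snd hB) ?_
      rintro _ ⟨A', hA', B', hB', rfl⟩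
      exact ⟨⟨A', hA', B' ∩ B, hB'.inter hB, by ext; simp; tauto⟩,
        ⟨A', hA', B' \ B, hB'.diff hB, by ext; simp; tauto⟩⟩
  have hdom : ∀ ρ : Measure (α × β),
      (∀ A B, MeasurableSet A → MeasurableSet B → ρ (A ×ˢ B) ≤ ν' (A ×ˢ B)) →
      ∀ S, ρ S ≤ O S := by
    intro ρ hρ
    have : ρ.toOuterMeasure ≤ O := by
      refine OuterMeasure.le_ofFunction.2 fun R => ?_
      by_cases hR : R ∈ C
      · rw [hcC hR]
        obtain ⟨A, hA, B, hB, rfl⟩ := hR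
        exact hρ A B hA hB
      · simp [hc, hR]
    exact this
  have huniv : O univ ≤ ν' univ := by
    refine (OuterMeasure.ofFunction_le _).trans_eq (hcC ⟨univ, .univ, univ, .univ, by simp⟩)
  refine Measure.le_iff.2 fun S hS => (hdom ν h S).trans ?_
  have h1 := (OuterMeasure.isCaratheodory_iff O).1 (hle S hS) univ
  have h2 : ν' Sᶜ ≤ O Sᶜ := hdom ν' (fun _ _ _ _ => le_rfl) _
  have h3 : O S + ν' Sᶜ ≤ ν' S + ν' Sᶜ := by
    rw [measure_add_measure_compl hS]
    refine le_trans ?_ huniv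
    rw [h1, univ_inter, ← compl_eq_univ_sdiff]
    gcongr
  exact (ENNReal.add_le_add_iff_right (measure_ne_top _ _)).1 h3

/-- Kernels whose weighted integrals over measurable sets are ordered are themselves ordered. -/
theorem ae_ae_le_of_forall_setLIntegral_le {Ω : Type*} [MeasurableSpace Ω] {μ : Measure Ω}
    [SigmaFinite μ] {w : Ω → ℝ≥0} (hw : Measurable w) (hw0 : ∀ x, 0 < w x)
    (hw1 : ∫⁻ x, w x ∂μ ≠ ∞) {m m' : Ω × Ω → ℝ≥0∞} (hm : Measurable m) (hm' : Measurable m')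
    (hfin : ∀ᵐ y ∂μ, ∫⁻ x, m' (x, y) * w x ∂μ < ∞)
    (h : ∀ A, MeasurableSet A →
      ∀ᵐ y ∂μ, ∫⁻ x in A, m (x, y) * w x ∂μ ≤ ∫⁻ x in A, m' (x, y) * w x ∂μ) :
    ∀ᵐ y ∂μ, ∀ᵐ x ∂μ, m (x, y) ≤ m' (x, y) := by
  set u : Ω → ℝ≥0∞ := fun y => ∫⁻ x, m' (x, y) * w x ∂μ with hu
  have hum : Measurable u := by
    refine Measurable.lintegral_prod_left' (f := fun z : Ω × Ω => m' z * (w z.1 : ℝ≥0∞)) ?_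
    fun_prop
  set v : Ω → ℝ≥0∞ := fun y => w y * (1 + u y)⁻¹ with hv
  have hvm : Measurable v := by fun_prop
  have hint : ∀ n : Ω × Ω → ℝ≥0∞, Measurable n → ∀ A B, MeasurableSet A → MeasurableSet B →
      (μ.prod μ).withDensity (fun z => n z * w z.1 * v z.2) (A ×ˢ B) =
        ∫⁻ y in B, (∫⁻ x in A, n (x, y) * w x ∂μ) * v y ∂μ := by
    intro n hn A B hA hB
    rw [withDensity_apply _ (hA.prod hB), ← Measure.prod_restrict,
      lintegral_prod_symm _ (by fun_prop)]
    refine lintegral_congr fun y => ?_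
    exact lintegral_mul_const (v y) (f := fun x => n (x, y) * (w x : ℝ≥0∞)) (by fun_prop)
  have hfinite : IsFiniteMeasure ((μ.prod μ).withDensity fun z => m' z * w z.1 * v z.2) := by
    refine ⟨?_⟩
    rw [← univ_prod_univ, hint m' hm' _ _ .univ .univ]
    simp only [Measure.restrict_univ]
    refine lt_of_le_of_lt (lintegral_mono fun y => ?_) hw1.lt_top
    change u y * (w y * (1 + u y)⁻¹) ≤ w y
    calc u y * (w y * (1 + u y)⁻¹) = w y * (u y * (1 + u y)⁻¹) := by ring
      _ ≤ w y * 1 := by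
        gcongr
        rw [← div_eq_mul_inv]
        exact ENNReal.div_le_of_le_mul (by rw [one_mul]; exact le_add_self)
      _ = w y := mul_one _
  have hle : (μ.prod μ).withDensity (fun z => m z * w z.1 * v z.2) ≤
      (μ.prod μ).withDensity fun z => m' z * w z.1 * v z.2 := by
    refine Measure.le_of_forall_prod_le fun A B hA hB => ?_
    rw [hint m hm A B hA hB, hint m' hm' A B hA hB]
    refine lintegral_mono_ae (ae_restrict_of_ae ?_)
    filter_upwards [h A hA] with y hy
    gcongr
  have hae : (fun z => m z * w z.1 * v z.2) ≤ᵐ[μ.prod μ] fun z => m' z * w z.1 * v z.2 := by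
    refine ae_le_of_forall_setLIntegral_le_of_sigmaFinite (by fun_prop) fun S hS _ => ?_
    rw [← withDensity_apply _ hS, ← withDensity_apply _ hS]
    exact hle S
  have hae' : ∀ᵐ y ∂μ, ∀ᵐ x ∂μ, m (x, y) * w x * v y ≤ m' (x, y) * w x * v y := by
    refine (Measure.ae_ae_comm ?_).1 (Measure.ae_ae_of_ae_prod hae)
    exact measurableSet_le (f := fun z : Ω × Ω => m z * w z.1 * v z.2)
      (g := fun z : Ω × Ω => m' z * w z.1 * v z.2) (by fun_prop) (by fun_prop)
  filter_upwards [hae', hfin] with y hy hyfin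
  filter_upwards [hy] with x hx
  have hwx : (w x : ℝ≥0∞) ≠ 0 := by simpa using (hw0 x).ne'
  have hvy0 : v y ≠ 0 := by
    refine mul_ne_zero (by simpa using (hw0 y).ne') (ENNReal.inv_ne_zero.2 ?_)
    exact ENNReal.add_ne_top.2 ⟨ENNReal.one_ne_top, hyfin.ne⟩
  have hvy : v y ≠ ∞ := by
    refine ENNReal.mul_ne_top ENNReal.coe_ne_top (ENNReal.inv_ne_top.2 ?_)
    simp
  rw [mul_assoc, mul_assoc] at hx
  exact (ENNReal.mul_le_mul_iff_left (mul_ne_zero hwx hvy0)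
    (ENNReal.mul_ne_top ENNReal.coe_ne_top hvy)).1 hx

/-- A class of `[0, ∞]`-valued functions that is closed under countable sums and contains all
multiples of a positive weight restricted to measurable sets contains all measurable functions. -/
theorem measurable_induction_of_tsum {X : Type*} [MeasurableSpace X] {κ : X → ℝ≥0}
    (hκ : Measurable κ) (hκ0 : ∀ x, 0 < κ x) {P : (X → ℝ≥0∞) → Prop}
    (hsum : ∀ k : ℕ → X → ℝ≥0∞, (∀ j, Measurable (k j)) → (∀ j, P (k j)) →
      P fun x => ∑' j, k j x)
    (hind : ∀ (c : ℝ≥0) (E : Set X), MeasurableSet E → P (E.indicator fun x => c * κ x))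
    {k : X → ℝ≥0∞} (hk : Measurable k) : P k := by
  have hzero : P fun _ => 0 := by
    have := hind 0 ∅ .empty
    rwa [indicator_empty] at this
  have hfinsum : ∀ (F : ℝ≥0 → X → ℝ≥0∞) (s : Finset ℝ≥0), (∀ r, Measurable (F r)) →
      (∀ r, P (F r)) → P fun x => ∑ r ∈ s, F r x := by
    classical
    intro F s hF hP
    induction s using Finset.induction_on with
    | empty => simpa using hzero
    | insert r s hr ih =>
      have := hsum (fun j x => if j = 0 then F r x else if j = 1 then ∑ r ∈ s, F r x else 0)
        (fun j => by rcases j with _ | _ | j <;> simp <;> fun_prop)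
        (fun j => by
          rcases j with _ | _ | j
          · simpa using hP r
          · simpa using ih
          · simpa using hzero)
      convert this using 2 with x
      rw [Finset.sum_insert hr, tsum_eq_sum (s := {0, 1}) (by
        intro j hj
        simp only [Finset.mem_insert, Finset.mem_singleton, not_or] at hj
        simp [hj.1, hj.2])]
      simp
  have hsimple : ∀ s : SimpleFunc X ℝ≥0, P fun x => s x * κ x := by
    classical
    intro s
    have := hfinsum (fun r => (s ⁻¹' {r}).indicator fun x => r * κ x) s.range
      (fun r => Measurable.indicator (by fun_prop) (s.measurableSet_preimage _))
      (fun r => hind r _ (s.measurableSet_preimage _))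
    convert this using 2 with x
    rw [Finset.sum_eq_single (s x)]
    · simp [indicator]
    · intro r _ hr
      exact indicator_of_notMem (by simpa using hr.symm) _
    · simp
  set g : X → ℝ≥0∞ := fun x => k x * (κ x : ℝ≥0∞)⁻¹ with hg
  have hgm : Measurable g := by fun_prop
  have := hsum (fun n x => SimpleFunc.eapproxDiff g n x * κ x)
    (fun n => by fun_prop) (fun n => hsimple _)
  convert this using 2 with x
  rw [ENNReal.tsum_mul_right, SimpleFunc.tsum_eapproxDiff g hgm, hg]
  simp only
  rw [mul_assoc, ENNReal.inv_mul_cancel (by simpa using (hκ0 x).ne') ENNReal.coe_ne_top, mul_one]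

theorem exists_weight {Ω : Type*} [MeasurableSpace Ω] (μ : Measure Ω) [SigmaFinite μ] :
    ∃ w : Ω → ℝ≥0, Measurable w ∧ (∀ x, 0 < w x) ∧ (∀ x, w x ≤ 1) ∧ ∫⁻ x, w x ∂μ ≠ ∞ := by
  obtain ⟨g, hg0, hg, hgi⟩ := exists_pos_lintegral_lt_of_sigmaFinite μ one_ne_zero
  refine ⟨fun x => min (g x) 1, by fun_prop, fun x => lt_min (hg0 x) one_pos,
    fun x => min_le_right _ _, ne_top_of_le_ne_top (hgi.trans ENNReal.one_lt_top).ne ?_⟩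
  exact lintegral_mono fun x => ENNReal.coe_le_coe.2 (min_le_left _ _)

theorem memLp_weight {Ω : Type*} [MeasurableSpace Ω] {μ : Measure Ω} {p : ℝ≥0∞} [Fact (1 ≤ p)]
    (hp : p ≠ ∞) {w : Ω → ℝ≥0} (hw : Measurable w) (hw1 : ∀ x, w x ≤ 1)
    (hwi : ∫⁻ x, w x ∂μ ≠ ∞) : MemLp (fun x => (w x : ℝ)) p μ := by
  have h1 : (1 : ℝ≥0∞) ≤ p := Fact.out
  refine ⟨by fun_prop, ?_⟩
  rw [eLpNorm_lt_top_iff_lintegral_rpow_enorm_lt_top (zero_lt_one.trans_le h1).ne' hp]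
  refine lt_of_le_of_lt (lintegral_mono fun x => ?_) hwi.lt_top
  have h2 : ‖(w x : ℝ)‖ₑ = (w x : ℝ≥0∞) := by simp [enorm, NNReal.nnnorm_eq]
  rw [h2]
  refine (ENNReal.rpow_le_rpow_of_exponent_ge (by exact_mod_cast hw1 x) ?_).trans_eq
    (ENNReal.rpow_one _)
  simpa using ENNReal.toReal_mono hp h1

theorem Lp_lintegral_weight_lt_top {Ω : Type*} [MeasurableSpace Ω] {μ : Measure Ω} {p : ℝ≥0∞}
    [Fact (1 ≤ p)] {w : Ω → ℝ≥0} (hw : Measurable w) (hw1 : ∀ x, w x ≤ 1)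
    (hwi : ∫⁻ x, w x ∂μ ≠ ∞) (f : Lp ℝ p μ) : ∫⁻ x, w x * ENNReal.ofReal (f x) ∂μ < ∞ := by
  have : IsFiniteMeasure (μ.withDensity fun x => (w x : ℝ≥0∞)) :=
    isFiniteMeasure_withDensity hwi
  have hle : (μ.withDensity fun x => (w x : ℝ≥0∞)) ≤ μ := by
    refine (withDensity_mono (g := 1) (.of_forall fun x => ?_)).trans_eq withDensity_one
    exact ENNReal.coe_le_one_iff.2 (hw1 x)
  have h := (((Lp.memLp f).mono_measure hle).mono_exponent (Fact.out : 1 ≤ p)).2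
  rw [eLpNorm_one_eq_lintegral_enorm, lintegral_withDensity_eq_lintegral_mul₀ (by fun_prop)
    (Lp.aestronglyMeasurable f).enorm] at h
  refine lt_of_le_of_lt (lintegral_mono fun x => ?_) h
  simp only [Pi.mul_apply]
  gcongr
  exact Real.ofReal_le_enorm _

theorem Lp_eq_of_ofReal_ae_eq {Ω : Type*} [MeasurableSpace Ω] {μ : Measure Ω} {p : ℝ≥0∞}
    {f g : Lp ℝ p μ} (hf : 0 ≤ f) (hg : 0 ≤ g)
    (h : (fun x => ENNReal.ofReal (f x)) =ᵐ[μ] fun x => ENNReal.ofReal (g x)) : f = g := by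
  refine Lp.ext ?_
  filter_upwards [h, (Lp.coeFn_nonneg f).2 hf, (Lp.coeFn_nonneg g).2 hg] with x hx h1 h2
  exact (ENNReal.ofReal_eq_ofReal_iff h1 h2).1 hx

theorem exists_Lp_of_le {Ω : Type*} [MeasurableSpace Ω] {μ : Measure Ω} {p : ℝ≥0∞}
    {u : Ω → ℝ≥0∞} (hu : AEMeasurable u μ) {g : Lp ℝ p μ}
    (hug : ∀ᵐ x ∂μ, u x ≤ ENNReal.ofReal (g x)) :
    ∃ f : Lp ℝ p μ, 0 ≤ f ∧ (fun x => ENNReal.ofReal (f x)) =ᵐ[μ] u := by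
  have hmem : MemLp (fun x => (u x).toReal) p μ := by
    refine (Lp.memLp g).of_le hu.ennreal_toReal.aestronglyMeasurable ?_
    filter_upwards [hug] with x hx
    have h1 := ENNReal.toReal_mono ENNReal.ofReal_ne_top hx
    rw [Real.norm_of_nonneg ENNReal.toReal_nonneg]
    refine h1.trans ?_
    rw [ENNReal.toReal_ofReal']
    exact max_le (Real.le_norm_self _) (norm_nonneg _)
  refine ⟨hmem.toLp, ?_, ?_⟩
  · rw [← Lp.coeFn_nonneg]
    filter_upwards [hmem.coeFn_toLp] with x hx
    rw [hx]
    exact ENNReal.toReal_nonneg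
  · filter_upwards [hmem.coeFn_toLp, hug] with x hx hux
    rw [hx, ENNReal.ofReal_toReal (ne_top_of_le_ne_top ENNReal.ofReal_ne_top hux)]

theorem exists_Lp_indicator_weight {Ω : Type*} [MeasurableSpace Ω] {μ : Measure Ω} {p : ℝ≥0∞}
    [Fact (1 ≤ p)] (hp : p ≠ ∞) {w : Ω → ℝ≥0} (hw : Measurable w) (hw1 : ∀ x, w x ≤ 1)
    (hwi : ∫⁻ x, w x ∂μ ≠ ∞) {A : Set Ω} (hA : MeasurableSet A) :
    ∃ f : Lp ℝ p μ, 0 ≤ f ∧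
      (fun x => ENNReal.ofReal (f x)) =ᵐ[μ] A.indicator fun x => (w x : ℝ≥0∞) := by
  have hwp := memLp_weight (p := p) hp hw hw1 hwi
  refine exists_Lp_of_le (g := hwp.toLp)
    (hw.coe_nnreal_ennreal.indicator hA).aemeasurable ?_
  filter_upwards [hwp.coeFn_toLp] with x hx
  rw [hx, ENNReal.ofReal_coe_nnreal]
  exact indicator_le_self _ _ _

theorem Lp_ofReal_smul {Ω : Type*} [MeasurableSpace Ω] {μ : Measure Ω} {p : ℝ≥0∞} (c : ℝ≥0)
    (f : Lp ℝ p μ) : (fun x => ENNReal.ofReal (((c : ℝ) • f : Lp ℝ p μ) x)) =ᵐ[μ]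
      fun x => c * ENNReal.ofReal (f x) := by
  filter_upwards [Lp.coeFn_smul (c : ℝ) f] with x hx
  rw [hx, Pi.smul_apply, smul_eq_mul, ENNReal.ofReal_mul (NNReal.coe_nonneg c),
    ENNReal.ofReal_coe_nnreal]

/-- Order continuity: positive operators commute with pointwise sums of nonnegative series
whose sum lies in `L^p`. -/
theorem IsPositiveOp.ofReal_map_tsum {Ω : Type*} [MeasurableSpace Ω] {μ : Measure Ω} {p : ℝ≥0∞}
    [Fact (1 ≤ p)] (hp : p ≠ ∞) {T : Lp ℝ p μ →L[ℝ] Lp ℝ p μ} (hT : IsPositiveOp T)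
    {f : Lp ℝ p μ} (hf : 0 ≤ f) {g : ℕ → Lp ℝ p μ} (hg : ∀ n, 0 ≤ g n)
    (h : (fun x => ENNReal.ofReal (f x)) =ᵐ[μ] fun x => ∑' n, ENNReal.ofReal (g n x)) :
    (fun x => ENNReal.ofReal (T f x)) =ᵐ[μ] fun x => ∑' n, ENNReal.ofReal (T (g n) x) := by
  have hp0 : p ≠ 0 := (zero_lt_one.trans_le (Fact.out : 1 ≤ p)).ne'
  have hpr : 0 < p.toReal := ENNReal.toReal_pos hp0 hp
  have hcoe : ∀ u : ℕ → Lp ℝ p μ, ∀ᵐ x ∂μ, ∀ N,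
      (∑ n ∈ Finset.range N, u n : Lp ℝ p μ) x = ∑ n ∈ Finset.range N, u n x := by
    intro u
    refine ae_all_iff.2 fun N => ?_
    filter_upwards [Lp.coeFn_finsetSum (Finset.range N) u] with x hx
    rw [hx, Finset.sum_apply]
  have hnn : ∀ u : ℕ → Lp ℝ p μ, (∀ n, 0 ≤ u n) → ∀ᵐ x ∂μ, ∀ n, 0 ≤ u n x := fun u hu =>
    ae_all_iff.2 fun n => (Lp.coeFn_nonneg _).2 (hu n)
  have hlim : Tendsto (fun N => ∑ n ∈ Finset.range N, g n) atTop (𝓝 f) := by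
    rw [Lp.tendsto_Lp_iff_tendsto_eLpNorm']
    have hbase : ∀ᵐ x ∂μ, HasSum (fun n => g n x) (f x) := by
      filter_upwards [h, hnn g hg, (Lp.coeFn_nonneg f).2 hf] with x hx hgx hfx
      have hs : Summable fun n => (g n x).toNNReal := by
        refine ENNReal.tsum_coe_ne_top_iff_summable.1 ?_
        exact hx ▸ ENNReal.ofReal_ne_top
      have hs' : Summable fun n => g n x := by
        have := NNReal.summable_coe.2 hs
        simpa [Real.coe_toNNReal _ (hgx _)] using this
      rw [← ENNReal.ofReal_tsum_of_nonneg hgx hs',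
        ENNReal.ofReal_eq_ofReal_iff hfx (tsum_nonneg hgx)] at hx
      exact hx ▸ hs'.hasSum
    have key : Tendsto (fun N => ∫⁻ x, ‖((∑ n ∈ Finset.range N, g n : Lp ℝ p μ) : Ω → ℝ) x - f x‖ₑ
        ^ p.toReal ∂μ) atTop (𝓝 (∫⁻ _, 0 ∂μ)) := by
      refine tendsto_lintegral_of_dominated_convergence' (fun x => ‖f x‖ₑ ^ p.toReal)
        (fun N => ?_) (fun N => ?_) ?_ ?_
      · exact (((Lp.aestronglyMeasurable _).sub (Lp.aestronglyMeasurable _)).enorm).pow_const _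
      · filter_upwards [hbase, hnn g hg, hcoe g, (Lp.coeFn_nonneg f).2 hf] with x hx hgx hcx hfx
        rw [hcx]
        gcongr ?_ ^ _
        have h1 := sum_le_hasSum (Finset.range N) (fun n _ => hgx n) hx
        have h2 := Finset.sum_nonneg (s := Finset.range N) fun n _ => hgx n
        rw [Real.enorm_eq_ofReal_abs, Real.enorm_eq_ofReal_abs, abs_of_nonneg hfx,
          abs_of_nonpos (sub_nonpos.2 h1)]
        exact ENNReal.ofReal_le_ofReal (by linarith)
      · exact ((eLpNorm_lt_top_iff_lintegral_rpow_enorm_lt_top hp0 hp).1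
          (Lp.memLp f).2).ne
      · filter_upwards [hbase, hcoe g] with x hx hcx
        have h1 : Tendsto (fun N => ∑ n ∈ Finset.range N, g n x - f x) atTop (𝓝 0) := by
          simpa using hx.tendsto_sum_nat.sub_const (f x)
        have h2 := (ENNReal.continuous_rpow_const (y := p.toReal)).tendsto _ |>.comp h1.enorm
        rw [enorm_zero, ENNReal.zero_rpow_of_pos hpr] at h2
        refine h2.congr fun N => ?_
        rw [Function.comp_apply, hcx]
    have h2 := (ENNReal.continuous_rpow_const (y := 1 / p.toReal)).tendsto _ |>.comp key
    simpa [eLpNorm_eq_lintegral_rpow_enorm_toReal hp0 hp, hpr, Function.comp_def] using h2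
  have hTlim : Tendsto (fun N => ∑ n ∈ Finset.range N, T (g n)) atTop (𝓝 (T f)) := by
    simpa [Function.comp_def] using (T.continuous.tendsto f).comp hlim
  obtain ⟨ns, hns, hae⟩ := (tendstoInMeasure_of_tendsto_Lp hTlim).exists_seq_tendsto_ae
  filter_upwards [hae, hcoe fun n => T (g n), hnn _ fun n => hT _ (hg n)] with x hx hcx hnx
  have h1 := (ENNReal.continuous_ofReal.tendsto _).comp hx
  have h2 := (ENNReal.tendsto_nat_tsum fun n => ENNReal.ofReal (T (g n) x)).comp
    hns.tendsto_atTop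
  refine tendsto_nhds_unique h1 (h2.congr fun i => ?_)
  simp only [Function.comp_apply, hcx]
  rw [ENNReal.ofReal_sum_of_nonneg fun n _ => hnx n]

/-- A positive operator is an integral operator once it is represented on nonnegative functions
by a `[0, ∞]`-valued kernel. -/
theorem IsPositiveOp.isIntegralOp_of_lintegral {Ω : Type*} [MeasurableSpace Ω] {μ : Measure Ω}
    [SigmaFinite μ] {p : ℝ≥0∞} [Fact (1 ≤ p)] (hp : p ≠ ∞) {S : Lp ℝ p μ →L[ℝ] Lp ℝ p μ}
    {m : Ω × Ω → ℝ≥0∞} (hm : Measurable m)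
    (h : ∀ f : Lp ℝ p μ, 0 ≤ f →
      (fun y => ENNReal.ofReal (S f y)) =ᵐ[μ] fun y => ∫⁻ x, m (x, y) * ENNReal.ofReal (f x) ∂μ)
    (hS : IsPositiveOp S) : IsIntegralOp S := by
  obtain ⟨w, hw, hw0, hw1, hwi⟩ := exists_weight μ
  have hwp := memLp_weight (p := p) hp hw hw1 hwi
  have hfin : ∀ᵐ y ∂μ, ∀ᵐ x ∂μ, m (x, y) < ∞ := by
    have hpos : 0 ≤ hwp.toLp := by
      rw [← Lp.coeFn_nonneg]
      filter_upwards [hwp.coeFn_toLp] with x hx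
      simp [hx]
    filter_upwards [h _ hpos] with y hy
    have h1 : ∫⁻ x, m (x, y) * ENNReal.ofReal ((hwp.toLp : Lp ℝ p μ) x) ∂μ ≠ ∞ :=
      hy ▸ ENNReal.ofReal_ne_top
    have h2 := ae_lt_top' (by
      refine AEMeasurable.mul (by fun_prop) ?_
      exact (Lp.aestronglyMeasurable _).aemeasurable.ennreal_ofReal) h1
    filter_upwards [h2, hwp.coeFn_toLp] with x hx hwx
    rw [hwx] at hx
    refine lt_top_iff_ne_top.2 fun htop => ?_
    rw [htop, ENNReal.top_mul (by simpa using (hw0 x).ne')] at hx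
    exact lt_irrefl _ hx
  have hint : ∀ f : Lp ℝ p μ, 0 ≤ f → ∀ᵐ y ∂μ, Integrable (fun x => (m (x, y)).toReal * f x) μ ∧
      S f y = ∫ x, (m (x, y)).toReal * f x ∂μ := by
    intro f hf
    filter_upwards [h f hf, hfin, (Lp.coeFn_nonneg _).2 (hS f hf)] with y hy hmy hSy
    have h0 : 0 ≤ᵐ[μ] fun x => (m (x, y)).toReal * f x := by
      filter_upwards [(Lp.coeFn_nonneg _).2 hf] with x hx
      exact mul_nonneg ENNReal.toReal_nonneg hx
    have h1 : ∫⁻ x, ENNReal.ofReal ((m (x, y)).toReal * f x) ∂μ = ENNReal.ofReal (S f y) := by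
      rw [hy]
      refine lintegral_congr_ae ?_
      filter_upwards [hmy] with x hx
      rw [ENNReal.ofReal_mul ENNReal.toReal_nonneg, ENNReal.ofReal_toReal hx.ne]
    have h2 : Integrable (fun x => (m (x, y)).toReal * f x) μ := by
      refine ⟨AEStronglyMeasurable.mul ?_ (Lp.aestronglyMeasurable _), ?_⟩
      · exact (Measurable.ennreal_toReal (by fun_prop)).aestronglyMeasurable
      · rw [hasFiniteIntegral_iff_ofReal h0, h1]
        exact ENNReal.ofReal_lt_top
    refine ⟨h2, ?_⟩
    rw [← ofReal_integral_eq_lintegral_ofReal h2 h0,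
      ENNReal.ofReal_eq_ofReal_iff (integral_nonneg_of_ae h0) hSy] at h1
    exact h1.symm
  refine ⟨fun x y => (m (x, y)).toReal, by
    simpa [Function.uncurry_def] using hm.ennreal_toReal, fun _ _ => ENNReal.toReal_nonneg,
    fun f => ?_⟩
  have hpn : ∀ g : Lp ℝ p μ, 0 ≤ Lp.posPart g := by
    intro g
    rw [← Lp.coeFn_nonneg]
    filter_upwards [Lp.coeFn_posPart g] with x hx
    rw [hx]
    exact le_max_right _ _
  have hsub : f = Lp.posPart f - Lp.posPart (-f) := by
    refine Lp.ext ?_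
    filter_upwards [Lp.coeFn_posPart f, Lp.coeFn_posPart (-f), Lp.coeFn_neg f,
      Lp.coeFn_sub (Lp.posPart f) (Lp.posPart (-f))] with x h1 h2 h3 h4
    rw [h4, Pi.sub_apply, h1, h2, h3, Pi.neg_apply]
    rcases le_total (f x) 0 with hx | hx <;> simp [hx]
  have hboth := (hint _ (hpn f)).and (hint _ (hpn (-f)))
  have hfx : (f : Ω → ℝ) =ᵐ[μ] fun x => Lp.posPart f x - Lp.posPart (-f) x := by
    conv_lhs => rw [hsub]
    exact Lp.coeFn_sub _ _
  have hSf : (S f : Ω → ℝ) =ᵐ[μ] fun x => S (Lp.posPart f) x - S (Lp.posPart (-f)) x := by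
    conv_lhs => rw [hsub, map_sub]
    exact Lp.coeFn_sub _ _
  have hprod : ∀ y, (fun x => (m (x, y)).toReal * f x) =ᵐ[μ] fun x =>
      (m (x, y)).toReal * Lp.posPart f x - (m (x, y)).toReal * Lp.posPart (-f) x := fun y => by
    filter_upwards [hfx] with x hx
    rw [hx, mul_sub]
  constructor
  · filter_upwards [hboth] with y hy
    exact (hy.1.1.sub hy.2.1).congr (hprod y).symm
  · filter_upwards [hboth, hSf] with y hy hSy
    rw [hSy, hy.1.2, hy.2.2, integral_congr_ae (hprod y), integral_sub hy.1.1 hy.2.1]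

theorem IsIntegralOp.exists_lintegral {Ω : Type*} [MeasurableSpace Ω] {μ : Measure Ω}
    {p : ℝ≥0∞} [Fact (1 ≤ p)] {S : Lp ℝ p μ →L[ℝ] Lp ℝ p μ} (hS : IsIntegralOp S) :
    ∃ m : Ω × Ω → ℝ≥0∞, Measurable m ∧ ∀ f : Lp ℝ p μ, 0 ≤ f →
      (fun y => ENNReal.ofReal (S f y)) =ᵐ[μ]
        fun y => ∫⁻ x, m (x, y) * ENNReal.ofReal (f x) ∂μ := by
  obtain ⟨k, hk, hk0, hkf⟩ := hS
  refine ⟨fun z => ENNReal.ofReal (k z.1 z.2), hk.ennreal_ofReal, fun f hf => ?_⟩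
  filter_upwards [(hkf f).1, (hkf f).2] with y hy hSy
  rw [hSy, ofReal_integral_eq_lintegral_ofReal hy]
  · simp_rw [ENNReal.ofReal_mul (hk0 _ y)]
  · filter_upwards [(Lp.coeFn_nonneg _).2 hf] with x hx
    exact mul_nonneg (hk0 x y) hx

theorem indicator_iUnion_eq_tsum {X : Type*} {E : ℕ → Set X}
    (hE : Pairwise (Function.onFun Disjoint E))
    (f : X → ℝ≥0∞) (x : X) : (⋃ j, E j).indicator f x = ∑' j, (E j).indicator f x := by
  by_cases hx : x ∈ ⋃ j, E j
  · obtain ⟨i, hi⟩ := mem_iUnion.1 hx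
    rw [indicator_of_mem hx, tsum_eq_single i, indicator_of_mem hi]
    exact fun j hj => indicator_of_notMem (fun hxj => disjoint_left.1 (hE hj) hxj hi) _
  · rw [indicator_of_notMem hx, eq_comm, ENNReal.tsum_eq_zero]
    exact fun j => indicator_of_notMem (fun hxj => hx (mem_iUnion.2 ⟨j, hxj⟩)) _

/-- The class of kernels whose associated relation is represented by a genuine kernel is closed
under monotone-class operations; hence it contains every measurable kernel. -/
theorem exists_kernel_of_rel {Ω : Type*} [MeasurableSpace Ω] {μ : Measure Ω} [SigmaFinite μ]
    {p : ℝ≥0∞} [Fact (1 ≤ p)] (hp : p ≠ ∞) {w : Ω → ℝ≥0} (hw : Measurable w)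
    (hw0 : ∀ x, 0 < w x) (hw1 : ∀ x, w x ≤ 1) (hwi : ∫⁻ x, w x ∂μ ≠ ∞)
    {Rel : (Ω × Ω → ℝ≥0∞) → Lp ℝ p μ → (Ω → ℝ≥0∞) → Prop}
    (huniq : ∀ k f r r', Rel k f r → Rel k f r' → r =ᵐ[μ] r')
    (hzero : ∀ f r, Rel (fun _ => 0) f r → r =ᵐ[μ] 0)
    (hsum : ∀ k : ℕ → Ω × Ω → ℝ≥0∞, (∀ j, Measurable (k j)) → ∀ f : Lp ℝ p μ, 0 ≤ f → ∀ r,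
      Rel (fun z => ∑' j, k j z) f r →
        ∃ s : ℕ → Ω → ℝ≥0∞, (∀ j, Rel (k j) f (s j)) ∧ r =ᵐ[μ] fun y => ∑' j, s j y)
    (hbase : ∀ (c : ℝ≥0) (f : Lp ℝ p μ), 0 ≤ f →
      ∃ r, Rel (fun z => c * (w z.1 * w z.2 : ℝ≥0)) f r ∧ ∀ᵐ y ∂μ, r y < ∞)
    (hrect : ∀ (c : ℝ≥0) (A B : Set Ω), MeasurableSet A → MeasurableSet B →
      ∃ m : Ω × Ω → ℝ≥0∞, Measurable m ∧ ∀ f : Lp ℝ p μ, 0 ≤ f → ∀ r,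
        Rel ((A ×ˢ B).indicator fun z => c * (w z.1 * w z.2 : ℝ≥0)) f r →
          r =ᵐ[μ] fun y => ∫⁻ x, m (x, y) * ENNReal.ofReal (f x) ∂μ)
    {k : Ω × Ω → ℝ≥0∞} (hk : Measurable k) :
    ∃ m : Ω × Ω → ℝ≥0∞, Measurable m ∧ ∀ f : Lp ℝ p μ, 0 ≤ f → ∀ r, Rel k f r →
      r =ᵐ[μ] fun y => ∫⁻ x, m (x, y) * ENNReal.ofReal (f x) ∂μ := by
  have hofReal : ∀ f : Lp ℝ p μ, AEMeasurable (fun x => ENNReal.ofReal (f x)) μ := fun f =>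
    (Lp.aestronglyMeasurable f).aemeasurable.ennreal_ofReal
  have hPsum : ∀ k : ℕ → Ω × Ω → ℝ≥0∞, (∀ j, Measurable (k j)) →
      (∀ j, ∃ m : Ω × Ω → ℝ≥0∞, Measurable m ∧ ∀ f : Lp ℝ p μ, 0 ≤ f → ∀ r, Rel (k j) f r →
        r =ᵐ[μ] fun y => ∫⁻ x, m (x, y) * ENNReal.ofReal (f x) ∂μ) →
      ∃ m : Ω × Ω → ℝ≥0∞, Measurable m ∧ ∀ f : Lp ℝ p μ, 0 ≤ f → ∀ r,
        Rel (fun z => ∑' j, k j z) f r →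
        r =ᵐ[μ] fun y => ∫⁻ x, m (x, y) * ENNReal.ofReal (f x) ∂μ := by
    intro k hk hP
    choose m hm hmf using hP
    refine ⟨fun z => ∑' j, m j z, by fun_prop, fun f hf r hr => ?_⟩
    obtain ⟨s, hs, hrs⟩ := hsum k hk f hf r hr
    filter_upwards [hrs, ae_all_iff.2 fun j => hmf j f hf _ (hs j)] with y hy hsy
    have hjm : ∀ j, Measurable fun x => m j (x, y) := fun j => by have := hm j; fun_prop
    simp_rw [hy, hsy, ← ENNReal.tsum_mul_right]
    exact (lintegral_tsum fun j => (hjm j).aemeasurable.mul (hofReal f)).symm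
  have hadd : ∀ k₁ k₂ : Ω × Ω → ℝ≥0∞, Measurable k₁ → Measurable k₂ → ∀ f : Lp ℝ p μ, 0 ≤ f →
      ∀ r, Rel (fun z => k₁ z + k₂ z) f r →
        ∃ r₁ r₂, Rel k₁ f r₁ ∧ Rel k₂ f r₂ ∧ r =ᵐ[μ] fun y => r₁ y + r₂ y := by
    intro k₁ k₂ hk₁ hk₂ f hf r hr
    have htwo : ∀ a : ℕ → ℝ≥0∞, (∀ j, a (j + 2) = 0) → ∑' j, a j = a 0 + a 1 := by
      intro a ha
      rw [tsum_eq_sum (s := Finset.range 2), Finset.sum_range_succ, Finset.sum_range_one]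
      intro j hj
      obtain ⟨i, rfl⟩ := Nat.exists_eq_add_of_le' (by simpa [Nat.lt_iff_add_one_le] using hj : 2 ≤ j)
      exact ha i
    let k : ℕ → Ω × Ω → ℝ≥0∞ := fun j => Nat.casesOn j k₁ fun i => Nat.casesOn i k₂ fun _ _ => 0
    obtain ⟨s, hs, hrs⟩ := hsum k
      (fun j => by rcases j with _ | _ | j; exacts [hk₁, hk₂, measurable_const]) f hf r (by
        convert hr using 2 with z
        exact htwo (fun j => k j z) fun _ => rfl)
    refine ⟨s 0, s 1, hs 0, hs 1, ?_⟩
    filter_upwards [hrs, ae_all_iff.2 fun j => hzero f _ (hs (j + 2))] with y hy h0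
    rw [hy, htwo _ h0]
  refine measurable_induction_of_tsum (κ := fun z : Ω × Ω => w z.1 * w z.2)
    (P := fun k => ∃ m : Ω × Ω → ℝ≥0∞, Measurable m ∧ ∀ f : Lp ℝ p μ, 0 ≤ f → ∀ r, Rel k f r →
      r =ᵐ[μ] fun y => ∫⁻ x, m (x, y) * ENNReal.ofReal (f x) ∂μ) (by fun_prop)
    (fun z => mul_pos (hw0 _) (hw0 _)) hPsum ?_ hk
  intro c E hE
  induction E, hE using MeasurableSpace.induction_on_inter generateFrom_prod.symm
    isPiSystem_prod with
  | empty =>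
    refine ⟨fun _ => 0, measurable_const, fun f hf r hr => ?_⟩
    rw [indicator_empty] at hr
    filter_upwards [hzero f r hr] with y hy
    simp [hy]
  | basic E hE =>
    obtain ⟨A, hA, B, hB, rfl⟩ := hE
    exact hrect c A B hA hB
  | compl E hE ih =>
    obtain ⟨m, hm, hmf⟩ := ih
    obtain ⟨M, hM, hMf⟩ := hrect c univ univ .univ .univ
    rw [univ_prod_univ, indicator_univ] at hMf
    have hκ : Measurable fun z : Ω × Ω => (c * (w z.1 * w z.2 : ℝ≥0) : ℝ≥0∞) := by fun_prop
    have hfull : ∀ f : Lp ℝ p μ, 0 ≤ f → ∃ r r₁ r₂,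
        Rel (E.indicator fun z => c * (w z.1 * w z.2 : ℝ≥0)) f r₁ ∧
        Rel (Eᶜ.indicator fun z => c * (w z.1 * w z.2 : ℝ≥0)) f r₂ ∧
        (r =ᵐ[μ] fun y => r₁ y + r₂ y) ∧ (∀ᵐ y ∂μ, r y < ∞) ∧
        r =ᵐ[μ] fun y => ∫⁻ x, M (x, y) * ENNReal.ofReal (f x) ∂μ := by
      intro f hf
      obtain ⟨r, hr, hrfin⟩ := hbase c f hf
      obtain ⟨r₁, r₂, h1, h2, h3⟩ := hadd _ _ (hκ.indicator hE) (hκ.indicator hE.compl) f hf r (by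
        convert hr using 2 with z
        exact indicator_self_add_compl_apply E _ z)
      exact ⟨r, r₁, r₂, h1, h2, h3, hrfin, hMf f hf r hr⟩
    have htest : ∀ A : Set Ω, MeasurableSet A → ∃ f : Lp ℝ p μ, 0 ≤ f ∧
        ∀ n : Ω → ℝ≥0∞, ∫⁻ x, n x * ENNReal.ofReal (f x) ∂μ = ∫⁻ x in A, n x * w x ∂μ := by
      intro A hA
      obtain ⟨f, hf, hfw⟩ := exists_Lp_indicator_weight (p := p) hp hw hw1 hwi hA
      refine ⟨f, hf, fun n => ?_⟩
      rw [← lintegral_indicator hA]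
      refine lintegral_congr_ae ?_
      filter_upwards [hfw] with x hx
      rw [hx]
      by_cases hxA : x ∈ A <;> simp [hxA]
    have hle : ∀ᵐ y ∂μ, ∀ᵐ x ∂μ, m (x, y) ≤ M (x, y) := by
      refine ae_ae_le_of_forall_setLIntegral_le hw hw0 hwi hm hM ?_ fun A hA => ?_
      · obtain ⟨f, hf, hfn⟩ := htest univ .univ
        obtain ⟨r, r₁, r₂, h1, h2, h3, h4, h5⟩ := hfull f hf
        filter_upwards [h4, h5] with y hy hy'
        rw [hy', hfn] at hy
        simpa using hy
      · obtain ⟨f, hf, hfn⟩ := htest A hA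
        obtain ⟨r, r₁, r₂, h1, h2, h3, h4, h5⟩ := hfull f hf
        filter_upwards [hmf f hf r₁ h1, h3, h5] with y h1y h3y h5y
        rw [← hfn, ← hfn, ← h1y, ← h5y, h3y]
        exact le_self_add
    refine ⟨fun z => M z - m z, by fun_prop, fun f hf r' hr' => ?_⟩
    obtain ⟨r, r₁, r₂, h1, h2, h3, h4, h5⟩ := hfull f hf
    filter_upwards [huniq _ _ _ _ hr' h2, h3, h4, h5, hmf f hf r₁ h1, hle]
      with y hy h3y h4y h5y h1y hley
    have hmy : Measurable fun x => m (x, y) := by fun_prop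
    have hsplit : r y = r₁ y + ∫⁻ x, (M (x, y) - m (x, y)) * ENNReal.ofReal (f x) ∂μ := by
      rw [h1y, ← lintegral_add_left' (hmy.aemeasurable.fun_mul (hofReal f)), h5y]
      refine lintegral_congr_ae ?_
      filter_upwards [hley] with x hx
      rw [← add_mul, add_tsub_cancel_of_le hx]
    rw [hy]
    refine (ENNReal.add_right_inj (a := r₁ y) ?_).1 (h3y.symm.trans hsplit)
    exact ne_top_of_le_ne_top h4y.ne (h3y ▸ le_self_add)
  | iUnion E hdisj hE ih =>
    have := hPsum (fun j => (E j).indicator fun z => c * (w z.1 * w z.2 : ℝ≥0))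
      (fun j => (by fun_prop : Measurable _).indicator (hE j)) ih
    rw [funext (indicator_iUnion_eq_tsum hdisj fun z => (c * (w z.1 * w z.2 : ℝ≥0) : ℝ≥0∞))]
    exact this

theorem Lp_eq_zero_of_ofReal_ae_eq_zero {Ω : Type*} [MeasurableSpace Ω] {μ : Measure Ω}
    {p : ℝ≥0∞} {f : Lp ℝ p μ} (hf : 0 ≤ f)
    (h : (fun x => ENNReal.ofReal (f x)) =ᵐ[μ] 0) : f = 0 := by
  refine Lp_eq_of_ofReal_ae_eq hf le_rfl ?_
  filter_upwards [h, Lp.coeFn_zero ℝ p μ] with x hx h0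
  rw [hx, h0, Pi.zero_apply, Pi.zero_apply, ENNReal.ofReal_zero]

theorem Lp_ofReal_zero {Ω : Type*} [MeasurableSpace Ω] {μ : Measure Ω} {p : ℝ≥0∞} :
    (fun x => ENNReal.ofReal ((0 : Lp ℝ p μ) x)) =ᵐ[μ] 0 := by
  filter_upwards [Lp.coeFn_zero ℝ p μ] with x hx
  rw [hx, Pi.zero_apply, Pi.zero_apply, ENNReal.ofReal_zero]

theorem Lp_measurable_ofReal {Ω : Type*} [MeasurableSpace Ω] {μ : Measure Ω} {p : ℝ≥0∞}
    (f : Lp ℝ p μ) : Measurable fun x => ENNReal.ofReal (f x) :=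
  (Lp.stronglyMeasurable f).measurable.ennreal_ofReal

theorem measurable_lintegral_kernel_mul {Ω : Type*} [MeasurableSpace Ω] {μ : Measure Ω}
    [SFinite μ] {k : Ω × Ω → ℝ≥0∞} (hk : Measurable k) {f : Ω → ℝ≥0∞} (hf : Measurable f) :
    Measurable fun y => ∫⁻ x, k (x, y) * f x ∂μ :=
  Measurable.lintegral_prod_left' (f := fun z : Ω × Ω => k z * f z.1) (by fun_prop)

theorem lintegral_kernel_tsum {Ω : Type*} [MeasurableSpace Ω] {μ : Measure Ω}
    {k : ℕ → Ω × Ω → ℝ≥0∞} (hk : ∀ j, Measurable (k j)) {f : Ω → ℝ≥0∞} (hf : Measurable f)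
    (y : Ω) : ∫⁻ x, (∑' j, k j (x, y)) * f x ∂μ = ∑' j, ∫⁻ x, k j (x, y) * f x ∂μ := by
  simp_rw [← ENNReal.tsum_mul_right]
  exact lintegral_tsum fun j => by have := hk j; fun_prop

theorem lintegral_prod_indicator_weight {Ω : Type*} [MeasurableSpace Ω] {μ : Measure Ω}
    {w : Ω → ℝ≥0} (hw : Measurable w) {A B : Set Ω} (hA : MeasurableSet A)
    (c : ℝ≥0) {f : Ω → ℝ≥0∞} (hf : Measurable f) (y : Ω) :
    ∫⁻ x, (A ×ˢ B).indicator (fun z => (c * (w z.1 * w z.2 : ℝ≥0) : ℝ≥0∞)) (x, y) * f x ∂μ =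
      (c * ∫⁻ x in A, w x * f x ∂μ) * B.indicator (fun y => (w y : ℝ≥0∞)) y := by
  have hfm : Measurable fun x => A.indicator (fun x => w x * f x) x :=
    Measurable.indicator (by fun_prop) hA
  rw [← lintegral_indicator hA, ← lintegral_const_mul _ hfm,
    ← lintegral_mul_const _ (by fun_prop)]
  refine lintegral_congr fun x => ?_
  by_cases hx : x ∈ A <;> by_cases hy : y ∈ B <;> simp [hx, hy]
  ring

/-- Composing an integral operator with a positive operator on the left yields an operator that
is again represented by a kernel. -/
theorem IsPositiveOp.exists_lintegral_comp_left {Ω : Type*} [MeasurableSpace Ω] {μ : Measure Ω}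
    [SigmaFinite μ] {p : ℝ≥0∞} [Fact (1 ≤ p)] (hp : p ≠ ∞) {T S : Lp ℝ p μ →L[ℝ] Lp ℝ p μ}
    (hT : IsPositiveOp T) (hS : IsPositiveOp S) (hSi : IsIntegralOp S) :
    ∃ m : Ω × Ω → ℝ≥0∞, Measurable m ∧ ∀ f : Lp ℝ p μ, 0 ≤ f →
      (fun y => ENNReal.ofReal (T (S f) y)) =ᵐ[μ]
        fun y => ∫⁻ x, m (x, y) * ENNReal.ofReal (f x) ∂μ := by
  obtain ⟨w, hw, hw0, hw1, hwi⟩ := exists_weight μ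
  obtain ⟨k, hk, hkf⟩ := hSi.exists_lintegral
  have hrank : ∀ (c : ℝ≥0) (A B : Set Ω), MeasurableSet A → MeasurableSet B →
      ∃ b : Lp ℝ p μ, ∀ f : Lp ℝ p μ, ∃ C : ℝ≥0,
        (C : ℝ≥0∞) = c * ∫⁻ x in A, w x * ENNReal.ofReal (f x) ∂μ ∧
        0 ≤ (C : ℝ) • b ∧
        (fun y => ENNReal.ofReal (((C : ℝ) • b : Lp ℝ p μ) y)) =ᵐ[μ] fun y =>
          ∫⁻ x, (A ×ˢ B).indicator (fun z => (c * (w z.1 * w z.2 : ℝ≥0) : ℝ≥0∞)) (x, y) *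
            ENNReal.ofReal (f x) ∂μ := by
    intro c A B hA hB
    obtain ⟨b, hb, hbB⟩ := exists_Lp_indicator_weight (p := p) hp hw hw1 hwi hB
    refine ⟨b, fun f => ?_⟩
    have hC : c * ∫⁻ x in A, w x * ENNReal.ofReal (f x) ∂μ ≠ ∞ :=
      ENNReal.mul_ne_top ENNReal.coe_ne_top (ne_top_of_le_ne_top
        (Lp_lintegral_weight_lt_top hw hw1 hwi f).ne (setLIntegral_le_lintegral _ _))
    refine ⟨_, ENNReal.coe_toNNReal hC, ?_, ?_⟩
    · rw [← Lp.coeFn_nonneg]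
      filter_upwards [Lp.coeFn_smul ((c * ∫⁻ x in A, w x * ENNReal.ofReal (f x) ∂μ).toNNReal : ℝ) b,
        (Lp.coeFn_nonneg b).2 hb] with x hx hbx
      rw [hx]
      exact mul_nonneg (NNReal.coe_nonneg _) hbx
    · filter_upwards [Lp_ofReal_smul (c * ∫⁻ x in A, w x * ENNReal.ofReal (f x) ∂μ).toNNReal b,
        hbB] with y hy hby
      rw [hy, hby, ENNReal.coe_toNNReal hC,
        lintegral_prod_indicator_weight hw hA c (Lp_measurable_ofReal f)]
  obtain ⟨m, hm, hmf⟩ := exists_kernel_of_rel hp hw hw0 hw1 hwi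
    (Rel := fun k f r => ∃ g : Lp ℝ p μ, 0 ≤ g ∧
      ((fun y => ENNReal.ofReal (g y)) =ᵐ[μ] fun y => ∫⁻ x, k (x, y) * ENNReal.ofReal (f x) ∂μ) ∧
      r =ᵐ[μ] fun y => ENNReal.ofReal (T g y))
    (by
      rintro k f r r' ⟨g, hg, hgk, hr⟩ ⟨g', hg', hgk', hr'⟩
      obtain rfl := Lp_eq_of_ofReal_ae_eq hg hg' (hgk.trans hgk'.symm)
      exact hr.trans hr'.symm)
    (by
      rintro f r ⟨g, hg, hgk, hr⟩
      obtain rfl := Lp_eq_zero_of_ofReal_ae_eq_zero hg (hgk.trans (by simp; rfl))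
      rw [map_zero] at hr
      exact hr.trans Lp_ofReal_zero)
    (by
      rintro k hk f hf r ⟨g, hg, hgk, hr⟩
      simp_rw [lintegral_kernel_tsum hk (Lp_measurable_ofReal f)] at hgk
      have hex : ∀ j, ∃ h : Lp ℝ p μ, 0 ≤ h ∧ (fun y => ENNReal.ofReal (h y)) =ᵐ[μ] fun y =>
          ∫⁻ x, k j (x, y) * ENNReal.ofReal (f x) ∂μ := fun j => by
        refine exists_Lp_of_le (g := g)
          (measurable_lintegral_kernel_mul (hk j) (Lp_measurable_ofReal f)).aemeasurable ?_
        filter_upwards [hgk] with y hy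
        exact hy ▸ ENNReal.le_tsum j
      choose h hh0 hh using hex
      refine ⟨fun j y => ENNReal.ofReal (T (h j) y), fun j => ⟨h j, hh0 j, hh j, .rfl⟩, ?_⟩
      refine hr.trans (hT.ofReal_map_tsum hp hg hh0 ?_)
      filter_upwards [hgk, ae_all_iff.2 hh] with y hy hhy
      rw [hy]
      exact tsum_congr fun j => (hhy j).symm)
    (by
      intro c f hf
      obtain ⟨b, hb⟩ := hrank c univ univ .univ .univ
      obtain ⟨C, -, hC0, hC⟩ := hb f
      refine ⟨_, ⟨_, hC0, by simpa using hC, .rfl⟩, ?_⟩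
      exact .of_forall fun y => ENNReal.ofReal_lt_top)
    (by
      intro c A B hA hB
      obtain ⟨b, hb⟩ := hrank c A B hA hB
      have hTb := Lp_measurable_ofReal (T b)
      refine ⟨fun z => c * A.indicator (fun x => (w x : ℝ≥0∞)) z.1 * ENNReal.ofReal (T b z.2),
        ?_, ?_⟩
      · have := hw.coe_nnreal_ennreal.indicator hA
        fun_prop
      · rintro f hf r ⟨g, hg, hgk, hr⟩
        obtain ⟨C, hCA, hC0, hC⟩ := hb f
        obtain rfl := Lp_eq_of_ofReal_ae_eq hg hC0 (hgk.trans hC.symm)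
        rw [map_smul] at hr
        filter_upwards [hr, Lp_ofReal_smul C (T b)] with y hy hby
        have hfm := Lp_measurable_ofReal f
        have hfA : Measurable fun x => A.indicator (fun x => w x * ENNReal.ofReal (f x)) x :=
          Measurable.indicator (by fun_prop) hA
        rw [hy, hby, hCA, ← lintegral_indicator hA, ← lintegral_const_mul _ hfA,
          ← lintegral_mul_const _ (by fun_prop)]
        refine lintegral_congr fun x => ?_
        by_cases hx : x ∈ A <;> simp [hx]
        ring)
    hk
  exact ⟨m, hm, fun f hf => hmf f hf _ ⟨S f, hS f hf, hkf f hf, .rfl⟩⟩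

/-- Weighted integrals of a positive operator are given by a density. -/
theorem IsPositiveOp.exists_setLIntegral_eq {Ω : Type*} [MeasurableSpace Ω] {μ : Measure Ω}
    [SigmaFinite μ] {p : ℝ≥0∞} [Fact (1 ≤ p)] (hp : p ≠ ∞) {S : Lp ℝ p μ →L[ℝ] Lp ℝ p μ}
    (hS : IsPositiveOp S) {w : Ω → ℝ≥0} (hw : Measurable w) (hw0 : ∀ x, 0 < w x)
    (hw1 : ∀ x, w x ≤ 1) (hwi : ∫⁻ x, w x ∂μ ≠ ∞) (A : Set Ω) :
    ∃ h : Ω → ℝ≥0∞, Measurable h ∧ ∀ f : Lp ℝ p μ, 0 ≤ f →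
      ∫⁻ x in A, w x * ENNReal.ofReal (S f x) ∂μ = ∫⁻ x, h x * ENNReal.ofReal (f x) ∂μ := by
  set Φ : Lp ℝ p μ → ℝ≥0∞ := fun f => ∫⁻ x in A, w x * ENNReal.ofReal (S f x) ∂μ with hΦ
  have hΦsum : ∀ f : Lp ℝ p μ, 0 ≤ f → ∀ g : ℕ → Lp ℝ p μ, (∀ n, 0 ≤ g n) →
      ((fun x => ENNReal.ofReal (f x)) =ᵐ[μ] fun x => ∑' n, ENNReal.ofReal (g n x)) →
      Φ f = ∑' n, Φ (g n) := by
    intro f hf g hg h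
    rw [← lintegral_tsum fun n => by have := Lp_measurable_ofReal (S (g n)); fun_prop]
    refine lintegral_congr_ae (ae_restrict_of_ae ?_)
    filter_upwards [hS.ofReal_map_tsum hp hf hg h] with x hx
    rw [hx, ENNReal.tsum_mul_left]
  have hΦ0 : Φ 0 = 0 := by
    rw [hΦ]
    simp only [map_zero]
    refine (lintegral_congr_ae (ae_restrict_of_ae ?_)).trans lintegral_zero
    filter_upwards [Lp_ofReal_zero (p := p) (μ := μ)] with x hx
    simpa using Or.inr hx
  have hΦsmul : ∀ (c : ℝ≥0) (f : Lp ℝ p μ), Φ ((c : ℝ) • f) = c * Φ f := by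
    intro c f
    have := Lp_measurable_ofReal (S f)
    rw [hΦ]
    simp only [map_smul]
    rw [← lintegral_const_mul _ (by fun_prop)]
    refine lintegral_congr_ae (ae_restrict_of_ae ?_)
    filter_upwards [Lp_ofReal_smul c (S f)] with x hx
    rw [hx]
    ring
  choose e he0 he using fun (B : Set Ω) (hB : MeasurableSet B) =>
    exists_Lp_indicator_weight (μ := μ) (p := p) hp hw hw1 hwi hB
  let ν : Measure Ω := Measure.ofMeasurable (fun B hB => Φ (e B hB))
    (by
      rw [Lp_eq_zero_of_ofReal_ae_eq_zero (he0 ∅ .empty)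
        ((he ∅ .empty).trans (by rw [indicator_empty]; rfl)), hΦ0])
    (by
      intro E hE hdisj
      refine hΦsum _ (he0 _ _) _ (fun n => he0 _ (hE n)) ?_
      filter_upwards [he _ (MeasurableSet.iUnion hE), ae_all_iff.2 fun n => he _ (hE n)]
        with x hx hxn
      simp_rw [hx, hxn]
      exact indicator_iUnion_eq_tsum hdisj _ x)
  have hν : ∀ B (hB : MeasurableSet B), ν B = Φ (e B hB) := fun B hB =>
    Measure.ofMeasurable_apply B hB
  have hfin : IsFiniteMeasure ν := by
    refine ⟨?_⟩
    rw [hν univ .univ]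
    exact (setLIntegral_le_lintegral _ _).trans_lt (Lp_lintegral_weight_lt_top hw hw1 hwi _)
  have hac : ν ≪ μ := by
    refine Measure.AbsolutelyContinuous.mk fun B hB hμB => ?_
    rw [hν B hB, Lp_eq_zero_of_ofReal_ae_eq_zero (he0 B hB)
      ((he B hB).trans (indicator_meas_zero hμB)), hΦ0]
  have hd : Measurable (ν.rnDeriv μ) := Measure.measurable_rnDeriv _ _
  refine ⟨fun x => ν.rnDeriv μ x * (w x : ℝ≥0∞)⁻¹, by fun_prop, fun f hf => ?_⟩
  refine measurable_induction_of_tsum hw hw0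
    (P := fun g => ∀ f : Lp ℝ p μ, 0 ≤ f → (fun x => ENNReal.ofReal (f x)) =ᵐ[μ] g →
      Φ f = ∫⁻ x, ν.rnDeriv μ x * (w x : ℝ≥0∞)⁻¹ * g x ∂μ)
    ?_ ?_ (Lp_measurable_ofReal f) f hf .rfl
  · intro k hk hP f hf hfk
    have hex : ∀ j, ∃ h : Lp ℝ p μ, 0 ≤ h ∧ (fun y => ENNReal.ofReal (h y)) =ᵐ[μ] k j :=
      fun j => by
        refine exists_Lp_of_le (g := f) (hk j).aemeasurable ?_
        filter_upwards [hfk] with y hy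
        exact hy ▸ ENNReal.le_tsum j
    choose h hh0 hh using hex
    rw [hΦsum f hf h hh0]
    · simp_rw [← ENNReal.tsum_mul_left]
      rw [lintegral_tsum fun j => by have := hk j; fun_prop]
      exact tsum_congr fun j => hP j (h j) (hh0 j) (hh j)
    · filter_upwards [hfk, ae_all_iff.2 hh] with y hy hhy
      rw [hy]
      exact tsum_congr fun j => (hhy j).symm
  · intro c E hE f hf hfE
    have hce : (fun x => ENNReal.ofReal (((c : ℝ) • e E hE : Lp ℝ p μ) x)) =ᵐ[μ]
        E.indicator fun x => (c * w x : ℝ≥0∞) := by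
      filter_upwards [Lp_ofReal_smul c (e E hE), he E hE] with x hx hex
      rw [hx, hex]
      by_cases hxE : x ∈ E <;> simp [hxE]
    have hce0 : 0 ≤ (c : ℝ) • e E hE := by
      rw [← Lp.coeFn_nonneg]
      filter_upwards [Lp.coeFn_smul (c : ℝ) (e E hE), (Lp.coeFn_nonneg _).2 (he0 E hE)]
        with x hx hbx
      rw [hx]
      exact mul_nonneg c.2 hbx
    obtain rfl := Lp_eq_of_ofReal_ae_eq hf hce0 (hfE.trans hce.symm)
    rw [hΦsmul, ← hν E hE, ← Measure.setLIntegral_rnDeriv hac E, ← lintegral_indicator hE,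
      ← lintegral_const_mul _ (hd.indicator hE)]
    refine lintegral_congr fun x => ?_
    by_cases hxE : x ∈ E
    · simp only [indicator_of_mem hxE]
      rw [mul_mul_mul_comm, mul_comm _ (c : ℝ≥0∞), mul_assoc,
        ENNReal.inv_mul_cancel (by simpa using (hw0 x).ne') ENNReal.coe_ne_top, mul_one]
    · simp [hxE]

/-- Composing an integral kernel with a positive operator on the right yields an operator that
is again represented by a kernel. -/
theorem IsPositiveOp.exists_lintegral_comp_right {Ω : Type*} [MeasurableSpace Ω] {μ : Measure Ω}
    [SigmaFinite μ] {p : ℝ≥0∞} [Fact (1 ≤ p)] (hp : p ≠ ∞) {S K : Lp ℝ p μ →L[ℝ] Lp ℝ p μ}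
    (hS : IsPositiveOp S) (hK : IsIntegralOp K) :
    ∃ m : Ω × Ω → ℝ≥0∞, Measurable m ∧ ∀ f : Lp ℝ p μ, 0 ≤ f →
      (fun y => ENNReal.ofReal (K (S f) y)) =ᵐ[μ]
        fun y => ∫⁻ x, m (x, y) * ENNReal.ofReal (f x) ∂μ := by
  obtain ⟨w, hw, hw0, hw1, hwi⟩ := exists_weight μ
  obtain ⟨k, hk, hkf⟩ := hK.exists_lintegral
  obtain ⟨m, hm, hmf⟩ := exists_kernel_of_rel hp hw hw0 hw1 hwi
    (Rel := fun k (f : Lp ℝ p μ) r => r =ᵐ[μ] fun y =>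
      ∫⁻ x, k (x, y) * ENNReal.ofReal (S f x) ∂μ)
    (fun k f r r' hr hr' => hr.trans hr'.symm)
    (fun f r hr => hr.trans (by simp; rfl))
    (by
      intro k hk f hf r hr
      refine ⟨_, fun j => .rfl, ?_⟩
      simpa only [lintegral_kernel_tsum hk (Lp_measurable_ofReal (S f))] using hr)
    (by
      intro c f hf
      refine ⟨_, .rfl, .of_forall fun y => ?_⟩
      have h := lintegral_prod_indicator_weight (μ := μ) (B := univ) hw .univ c
        (Lp_measurable_ofReal (S f)) y
      simp only [univ_prod_univ, indicator_univ, Measure.restrict_univ] at h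
      rw [h]
      exact ENNReal.mul_lt_top (ENNReal.mul_lt_top ENNReal.coe_lt_top
        (Lp_lintegral_weight_lt_top hw hw1 hwi _)) ENNReal.coe_lt_top)
    (by
      intro c A B hA hB
      obtain ⟨h, hh, hhf⟩ := hS.exists_setLIntegral_eq hp hw hw0 hw1 hwi A
      refine ⟨fun z => c * B.indicator (fun y => (w y : ℝ≥0∞)) z.2 * h z.1, ?_, ?_⟩
      · have := hw.coe_nnreal_ennreal.indicator hB
        fun_prop
      · intro f hf r hr
        refine hr.trans (.of_forall fun y => ?_)
        have hfm := Lp_measurable_ofReal f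
        simp only [lintegral_prod_indicator_weight hw hA c (Lp_measurable_ofReal (S f)), hhf f hf,
          mul_assoc]
        rw [← lintegral_mul_const _ (by fun_prop), ← lintegral_const_mul _ (by fun_prop)]
        refine lintegral_congr fun x => ?_
        ring)
    hk
  exact ⟨m, hm, fun f hf => hmf f hf _ (hkf _ (hS f hf))⟩

/-- If `K t` is the maximal positive integral operator dominated by `T t` and
`R t = T t - K t`, then the remainders satisfy `R (s+t) f ≤ R t (R s f)` for `f ≥ 0`. -/
theorem remainder_subadditive
    {Ω : Type*} [MeasurableSpace Ω] (μ : Measure Ω) [SigmaFinite μ]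
    (p : ℝ≥0∞) [Fact (1 ≤ p)] (hp : p ≠ ∞)
    (T : ℝ≥0 → (Lp ℝ p μ →L[ℝ] Lp ℝ p μ))
    (hpos : ∀ t, IsPositiveOp (T t))
    (hcontr : ∀ t (f : Lp ℝ p μ), ‖T t f‖ ≤ ‖f‖)
    (hT0 : T 0 = ContinuousLinearMap.id ℝ (Lp ℝ p μ))
    (hsem : ∀ s t, T (s + t) = (T s).comp (T t))
    (hcont : ∀ f : Lp ℝ p μ, Continuous fun t => T t f)
    (K : ℝ≥0 → (Lp ℝ p μ →L[ℝ] Lp ℝ p μ))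
    (hKpos : ∀ t, IsPositiveOp (K t))
    (hKker : ∀ t, IsIntegralOp (K t))
    (hKdom : ∀ t, ∀ f : Lp ℝ p μ, 0 ≤ f → K t f ≤ T t f)
    (hKmax : ∀ t, ∀ K' : Lp ℝ p μ →L[ℝ] Lp ℝ p μ, IsPositiveOp K' → IsIntegralOp K' →
      (∀ f : Lp ℝ p μ, 0 ≤ f → K' f ≤ T t f) → ∀ f : Lp ℝ p μ, 0 ≤ f → K' f ≤ K t f) :
    ∀ s t : ℝ≥0, ∀ f : Lp ℝ p μ, 0 ≤ f →
      (T (s + t) - K (s + t)) f ≤ (T t - K t) ((T s - K s) f) := by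
  intro s t f hf
  have hR : IsPositiveOp (T s - K s) := fun g hg => sub_nonneg.2 (hKdom s g hg)
  set K' : Lp ℝ p μ →L[ℝ] Lp ℝ p μ := (T t).comp (K s) + (K t).comp (T s - K s) with hK'
  have hTpos : ∀ g : Lp ℝ p μ, 0 ≤ g → 0 ≤ T t (K s g) := fun g hg =>
    hpos t _ (hKpos s g hg)
  have hKRpos : ∀ g : Lp ℝ p μ, 0 ≤ g → 0 ≤ K t ((T s - K s) g) := fun g hg =>
    hKpos t _ (hR g hg)
  have hK'pos : IsPositiveOp K' := fun g hg => add_nonneg (hTpos g hg) (hKRpos g hg)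
  have hK'int : IsIntegralOp K' := by
    obtain ⟨m₁, hm₁, h₁⟩ := (hpos t).exists_lintegral_comp_left hp (hKpos s) (hKker s)
    obtain ⟨m₂, hm₂, h₂⟩ := hR.exists_lintegral_comp_right hp (hKker t)
    refine IsPositiveOp.isIntegralOp_of_lintegral hp (hm₁.add hm₂) (fun g hg => ?_) hK'pos
    filter_upwards [h₁ g hg, h₂ g hg, Lp.coeFn_add (T t (K s g)) (K t ((T s - K s) g)),
      (Lp.coeFn_nonneg _).2 (hTpos g hg), (Lp.coeFn_nonneg _).2 (hKRpos g hg)]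
      with y h1y h2y hy h1 h2
    have hgm := Lp_measurable_ofReal g
    change ENNReal.ofReal ((T t (K s g) + K t ((T s - K s) g) : Lp ℝ p μ) y) = _
    rw [hy, Pi.add_apply, ENNReal.ofReal_add h1 h2, h1y, h2y,
      ← lintegral_add_left (by fun_prop)]
    simp only [Pi.add_apply, add_mul]
  have hcomp : ∀ g, T (s + t) g = T t (T s g) := fun g => by
    rw [add_comm, hsem]
    rfl
  have hK'dom : ∀ g : Lp ℝ p μ, 0 ≤ g → K' g ≤ T (s + t) g := by
    intro g hg
    have h1 : K t ((T s - K s) g) ≤ T t ((T s - K s) g) := hKdom t _ (hR g hg)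
    calc K' g = T t (K s g) + K t ((T s - K s) g) := rfl
      _ ≤ T t (K s g) + T t ((T s - K s) g) := by gcongr
      _ = T (s + t) g := by rw [hcomp, ← map_add, sub_apply]; congr 1; abel
  have hmax := hKmax (s + t) K' hK'pos hK'int hK'dom f hf
  calc (T (s + t) - K (s + t)) f = T (s + t) f - K (s + t) f := rfl
    _ ≤ T (s + t) f - K' f := sub_le_sub_left hmax _
    _ = (T t - K t) ((T s - K s) f) := by
      rw [hcomp, hK']
      simp only [add_apply, sub_apply,
        ContinuousLinearMap.comp_apply, map_sub]
      abel
end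
end

section
/- Let (Ω, μ) be a σ-finite measure space, let p ∈ [1, ∞), and let (T_t)_{t ∈ [0,∞)} be a positive and contractive C₀-semigroup on L^p(Ω, μ; ℝ). Assume there exists f₀ ∈ L^p with T_t f₀ = f₀ for all t ≥ 0 and f₀(x) > 0 for μ-almost every x ∈ Ω, and assume condition (*): for every f ∈ L^p with f ≥ 0, f ≠ 0 and T_t f = f for all t ≥ 0, there exist a time t ≥ 0 and a positive integral operator K on L^p such that K g ≤ T_t g for all g ≥ 0 and K f ≠ 0. Suppose moreover that for every t ≥ 0 there is a positive integral operator K_t on L^p with K_t f ≤ T_t f for all f ≥ 0, maximal in the sense that every positive integral operator K with K f ≤ T_t f for all f ≥ 0 satisfies K f ≤ K_t f for all f ≥ 0. Then ‖(T_t − K_t) f₀‖ → 0 as t → ∞. -/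
open MeasureTheory Filter
open scoped ENNReal NNReal

noncomputable section

open ProbabilityTheory

/-- A finite bimeasure, given through its families of marginals `τ` and `σ`, integrated in
one variable against a function of two variables, gives an s-finite kernel. -/
theorem exists_kernel_of_bimeasure {Ω : Type*} [MeasurableSpace Ω] (τ σ : Set Ω → Measure Ω)
    (hsymm : ∀ A C, MeasurableSet A → MeasurableSet C → τ C A = σ A C)
    (hfin : τ Set.univ Set.univ ≠ ∞) (h : Ω → Ω → ℝ≥0∞) (hh : Measurable (Function.uncurry h))
    (hhfin : ∀ x z, h x z ≠ ∞) :
    ∃ κ : Kernel Ω Ω, IsSFiniteKernel κ ∧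
      ∀ x C, MeasurableSet C → κ x C = ∫⁻ z, h x z ∂(τ C) := by
  have hmono : ∀ C, MeasurableSet C → τ C Set.univ ≤ τ Set.univ Set.univ := fun C hC => by
    rw [hsymm _ _ .univ hC, hsymm _ _ .univ .univ]
    exact measure_mono (Set.subset_univ _)
  have hfinC : ∀ C, MeasurableSet C → IsFiniteMeasure (τ C) := fun C hC =>
    ⟨lt_of_le_of_lt (hmono C hC) hfin.lt_top⟩
  have hbdd : ∀ (g : Ω → Ω → ℝ≥0∞), Measurable (Function.uncurry g) → ∀ c : ℝ≥0∞, c ≠ ∞ →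
      (∀ x z, g x z ≤ c) → ∃ κ : Kernel Ω Ω, IsFiniteKernel κ ∧
        ∀ x C, MeasurableSet C → κ x C = ∫⁻ z, g x z ∂(τ C) := by
    intro g hg c hc hgc
    let M : Ω → Measure Ω := fun x => Measure.ofMeasurable (fun C _ => ∫⁻ z, g x z ∂(τ C))
      (by
        have : τ ∅ = 0 := by
          ext A hA
          rw [hsymm _ _ hA .empty]; simp
        simp [this])
      (by
        intro C hC hd
        have : τ (⋃ i, C i) = Measure.sum fun i => τ (C i) := by
          ext A hA
          rw [Measure.sum_apply _ hA, hsymm _ _ hA (.iUnion hC), measure_iUnion hd hC]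
          exact tsum_congr fun i => (hsymm _ _ hA (hC i)).symm
        rw [this, lintegral_sum_measure])
    have hM : ∀ x C, MeasurableSet C → M x C = ∫⁻ z, g x z ∂(τ C) := fun x C hC =>
      Measure.ofMeasurable_apply C hC
    refine ⟨⟨M, ?_⟩, ⟨c * τ Set.univ Set.univ, ENNReal.mul_lt_top hc.lt_top hfin.lt_top, ?_⟩, hM⟩
    · refine Measure.measurable_of_measurable_coe _ fun C hC => ?_
      simp only [hM _ _ hC]
      have := hfinC C hC
      exact Measurable.lintegral_prod_right hg
    · intro x
      change M x Set.univ ≤ _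
      rw [hM _ _ .univ, ← lintegral_const]
      exact lintegral_mono fun z => hgc x z
  let piece : ℕ → Ω → Ω → ℝ≥0∞ := fun n x z => if ⌊(h x z).toReal⌋₊ = n then h x z else 0
  have hpm : ∀ n, Measurable (Function.uncurry (piece n)) := fun n =>
    Measurable.ite (measurableSet_eq_fun (Nat.measurable_floor.comp hh.ennreal_toReal)
      measurable_const) hh measurable_const
  have hpb : ∀ n x z, piece n x z ≤ ((n + 1 : ℕ) : ℝ≥0∞) := by
    intro n x z
    simp only [piece]
    split_ifs with hn
    · have := (Nat.lt_floor_add_one (h x z).toReal).le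
      rw [hn] at this
      rw [← ENNReal.ofReal_toReal (hhfin x z), ← ENNReal.ofReal_natCast]
      exact ENNReal.ofReal_le_ofReal (by exact_mod_cast this)
    · exact zero_le
  have hps : ∀ x z, ∑' n, piece n x z = h x z := by
    intro x z
    rw [tsum_eq_single ⌊(h x z).toReal⌋₊]
    · simp [piece]
    · intro n hn
      simp [piece, hn.symm]
  choose κ hκf hκ using fun n => hbdd (piece n) (hpm n) _ (ENNReal.natCast_ne_top (n + 1)) (hpb n)
  refine ⟨Kernel.sum κ, inferInstance, fun x C hC => ?_⟩
  rw [Kernel.sum_apply' _ _ hC]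
  simp only [hκ _ _ _ hC]
  rw [← lintegral_tsum fun n => (Measurable.of_uncurry_left (hpm n)).aemeasurable]
  simp only [hps]

section

variable {Ω : Type*} [MeasurableSpace Ω] {μ : Measure Ω} {p : ℝ≥0∞}

/-- The restriction of `f ∈ L^p` to a measurable set, extended by zero. -/
def Lp.cut (f : Lp ℝ p μ) (B : Set Ω) : Lp ℝ p μ :=
  open Classical in
  if hB : MeasurableSet B then ((Lp.memLp f).indicator hB).toLp else 0

theorem Lp.coeFn_cut (f : Lp ℝ p μ) {B : Set Ω} (hB : MeasurableSet B) :
    (Lp.cut f B : Ω → ℝ) =ᵐ[μ] B.indicator f := by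
  rw [Lp.cut, dif_pos hB]
  exact MemLp.coeFn_toLp _

theorem Lp.cut_nonneg {f : Lp ℝ p μ} (hf : 0 ≤ f) (B : Set Ω) : 0 ≤ Lp.cut f B := by
  by_cases hB : MeasurableSet B
  · rw [← Lp.coeFn_nonneg]
    filter_upwards [Lp.coeFn_cut f hB, (Lp.coeFn_nonneg f).2 hf] with x h1 h2
    rw [h1]
    exact Set.indicator_apply_nonneg fun _ => h2
  · rw [Lp.cut, dif_neg hB]

theorem Lp.cut_eq_zero (f : Lp ℝ p μ) {B : Set Ω} (hB : MeasurableSet B) (h0 : μ B = 0) :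
    Lp.cut f B = 0 := by
  apply Lp.ext
  filter_upwards [Lp.coeFn_cut f hB, Lp.coeFn_zero ℝ p μ, measure_eq_zero_iff_ae_notMem.1 h0]
    with x h1 h2 h3
  rw [h1, h2]
  simp [h3]

theorem Lp.exists_of_le_mul {f₀ g : Lp ℝ p μ} {u v : Ω → ℝ≥0∞} (hu : Measurable u)
    (huv : u ≤ v) (hg : ∀ᵐ x ∂μ, ENNReal.ofReal (g x) = ENNReal.ofReal (f₀ x) * v x) :
    ∃ g' : Lp ℝ p μ, 0 ≤ g' ∧
      ∀ᵐ x ∂μ, ENNReal.ofReal (g' x) = ENNReal.ofReal (f₀ x) * u x := by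
  have hle : ∀ᵐ x ∂μ, ENNReal.ofReal (f₀ x) * u x ≤ ENNReal.ofReal (g x) := by
    filter_upwards [hg] with x hx
    rw [hx]
    gcongr
    exact huv x
  have hmem : MemLp (fun x => (ENNReal.ofReal (f₀ x) * u x).toReal) p μ := by
    refine (Lp.memLp g).of_le ?_ ?_
    · exact (((Lp.stronglyMeasurable f₀).measurable.ennreal_ofReal.mul
        hu).ennreal_toReal).aestronglyMeasurable
    · filter_upwards [hle] with x hx
      rw [Real.norm_of_nonneg ENNReal.toReal_nonneg]
      refine (ENNReal.toReal_mono ENNReal.ofReal_ne_top hx).trans ?_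
      rw [ENNReal.toReal_ofReal']
      exact max_le (le_abs_self _) (abs_nonneg _)
  refine ⟨hmem.toLp, ?_, ?_⟩
  · rw [← Lp.coeFn_nonneg]
    filter_upwards [hmem.coeFn_toLp] with x hx
    rw [hx]
    exact ENNReal.toReal_nonneg
  · filter_upwards [hmem.coeFn_toLp, hle] with x hx h1
    rw [hx, ENNReal.ofReal_toReal (ne_top_of_le_ne_top ENNReal.ofReal_ne_top h1)]

/-- A positive density with finite total mass making a given `L^p` function integrable. -/
theorem exists_weight_s10 [SigmaFinite μ] (g : Lp ℝ p μ) :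
    ∃ q : Ω → ℝ≥0∞, Measurable q ∧ (∀ x, q x ≠ 0) ∧ (∀ x, q x ≠ ∞) ∧
      ∫⁻ x, q x ∂μ ≠ ∞ ∧ ∫⁻ x, ENNReal.ofReal (g x) ∂(μ.withDensity q) ≠ ∞ := by
  obtain ⟨w, hw0, hwm, hw⟩ := exists_pos_lintegral_lt_of_sigmaFinite μ one_ne_zero
  have hmeas : Measurable fun x => ENNReal.ofReal (g x) :=
    (Lp.stronglyMeasurable g).measurable.ennreal_ofReal
  have hq : Measurable fun x => (w x : ℝ≥0∞) / (1 + ENNReal.ofReal (g x)) :=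
    hwm.coe_nnreal_ennreal.div (measurable_const.add hmeas)
  refine ⟨fun x => w x / (1 + ENNReal.ofReal (g x)), hq, fun x => ?_, fun x => ?_, ?_, ?_⟩
  · exact ENNReal.div_ne_zero.2 ⟨by simpa using (hw0 x).ne', by simp⟩
  · exact ENNReal.div_ne_top ENNReal.coe_ne_top (by simp)
  · refine ne_top_of_le_ne_top hw.ne_top (lintegral_mono fun x => ?_)
    exact ENNReal.div_le_of_le_mul (le_mul_of_one_le_right zero_le le_self_add)
  · rw [lintegral_withDensity_eq_lintegral_mul _ hq hmeas]
    refine ne_top_of_le_ne_top hw.ne_top (lintegral_mono fun x => ?_)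
    calc (w x : ℝ≥0∞) / (1 + ENNReal.ofReal (g x)) * ENNReal.ofReal (g x)
        ≤ (w x : ℝ≥0∞) / (1 + ENNReal.ofReal (g x)) * (1 + ENNReal.ofReal (g x)) := by
          gcongr; exact le_add_self
      _ = w x := ENNReal.div_mul_cancel (by simp) (by simp)

variable [Fact (1 ≤ p)]

/-- Dominated convergence in `L^p`. -/
theorem Lp_tendsto_of_ae_of_le (hp : p ≠ ∞) (F : ℕ → Lp ℝ p μ) (f g : Lp ℝ p μ)
    (hF : ∀ n, |F n| ≤ g) (hlim : ∀ᵐ x ∂μ, Tendsto (fun n => F n x) atTop (nhds (f x))) :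
    Tendsto F atTop (nhds f) := by
  have hp0 : p ≠ 0 := (lt_of_lt_of_le one_pos (Fact.out : 1 ≤ p)).ne'
  have hpr : 0 < p.toReal := ENNReal.toReal_pos hp0 hp
  have hFg : ∀ᵐ x ∂μ, ∀ n, |F n x| ≤ g x := by
    rw [ae_all_iff]
    intro n
    filter_upwards [(Lp.coeFn_le _ _).2 (hF n), Lp.coeFn_abs (F n)] with x h1 h2
    rwa [h2] at h1
  have hfg : ∀ᵐ x ∂μ, |f x| ≤ g x := by
    filter_upwards [hFg, hlim] with x h1 h2
    exact le_of_tendsto h2.abs (Eventually.of_forall h1)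
  rw [Lp.tendsto_Lp_iff_tendsto_eLpNorm']
  have hcongr : ∀ n, eLpNorm (F n - f : Ω → ℝ) p μ = eLpNorm (F n - f : Lp ℝ p μ) p μ := fun n =>
    (eLpNorm_congr_ae (Lp.coeFn_sub _ _)).symm
  simp only [hcongr, eLpNorm_eq_lintegral_rpow_enorm_toReal hp0 hp]
  have key : Tendsto (fun n => ∫⁻ x, ‖(F n - f : Lp ℝ p μ) x‖ₑ ^ p.toReal ∂μ) atTop (nhds 0) := by
    have h0 : ∫⁻ _ : Ω, (0 : ℝ≥0∞) ∂μ = 0 := by simp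
    rw [← h0]
    refine tendsto_lintegral_of_dominated_convergence'
      (fun x => ‖((2 : ℝ) • g : Lp ℝ p μ) x‖ₑ ^ p.toReal) (fun n => ?_) (fun n => ?_) ?_ ?_
    · exact ((Lp.aestronglyMeasurable _).enorm).pow_const _
    · filter_upwards [Lp.coeFn_sub (F n) f, Lp.coeFn_smul (2 : ℝ) g, hFg, hfg] with x h1 h2 h3 h4
      rw [h1, h2]
      gcongr
      rw [enorm_le_iff_norm_le]
      simp only [Pi.sub_apply, Pi.smul_apply, smul_eq_mul, Real.norm_eq_abs]
      have := h3 n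
      calc |F n x - f x| ≤ |F n x| + |f x| := abs_sub _ _
        _ ≤ 2 * g x := by linarith
        _ ≤ _ := le_abs_self _
    · exact (lintegral_rpow_enorm_lt_top_of_eLpNorm_lt_top hp0 hp (Lp.eLpNorm_lt_top _)).ne
    · have hsub : ∀ᵐ x ∂μ, ∀ n, (F n - f : Lp ℝ p μ) x = F n x - f x :=
        ae_all_iff.2 fun n => Lp.coeFn_sub (F n) f
      filter_upwards [hlim, hsub] with x h1 h2
      simp only [h2]
      have h3 : Tendsto (fun n => ‖F n x - f x‖ₑ) atTop (nhds 0) := by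
        have := (tendsto_sub_nhds_zero_iff.2 h1).enorm
        simpa using this
      have := h3.ennrpow_const p.toReal
      rwa [ENNReal.zero_rpow_of_pos hpr] at this
  have := key.ennrpow_const (1 / p.toReal)
  rwa [ENNReal.zero_rpow_of_pos (by positivity)] at this

theorem IsPositiveOp.mono {S : Lp ℝ p μ →L[ℝ] Lp ℝ p μ} (hS : IsPositiveOp S)
    {f g : Lp ℝ p μ} (h : f ≤ g) : S f ≤ S g := by
  have := hS (g - f) (sub_nonneg.2 h)
  rwa [map_sub, sub_nonneg] at this

/-- Positive operators on `L^p` are order continuous. -/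
theorem IsPositiveOp.tendsto_ae (hp : p ≠ ∞) {S : Lp ℝ p μ →L[ℝ] Lp ℝ p μ} (hS : IsPositiveOp S)
    (F : ℕ → Lp ℝ p μ) (f : Lp ℝ p μ) (h0 : ∀ n, 0 ≤ F n) (hmono : Monotone F)
    (hlim : ∀ᵐ x ∂μ, Tendsto (fun n => F n x) atTop (nhds (f x))) :
    ∀ᵐ x ∂μ, Monotone (fun n => S (F n) x) ∧
      Tendsto (fun n => S (F n) x) atTop (nhds (S f x)) := by
  have hp0 : p ≠ 0 := (lt_of_lt_of_le one_pos (Fact.out : 1 ≤ p)).ne'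
  have hm : ∀ᵐ x ∂μ, Monotone fun n => F n x := by
    have : ∀ᵐ x ∂μ, ∀ n, F n x ≤ F (n + 1) x :=
      ae_all_iff.2 fun n => (Lp.coeFn_le _ _).2 (hmono n.le_succ)
    filter_upwards [this] with x hx using monotone_nat_of_le_succ hx
  have hSm : ∀ᵐ x ∂μ, Monotone fun n => S (F n) x := by
    have : ∀ᵐ x ∂μ, ∀ n, S (F n) x ≤ S (F (n + 1)) x :=
      ae_all_iff.2 fun n => (Lp.coeFn_le _ _).2 (hS.mono (hmono n.le_succ))
    filter_upwards [this] with x hx using monotone_nat_of_le_succ hx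
  have hle : ∀ n, |F n| ≤ f := fun n => by
    rw [abs_of_nonneg (h0 n), ← Lp.coeFn_le]
    filter_upwards [hm, hlim] with x h1 h2 using h1.ge_of_tendsto h2 n
  have hconv : Tendsto (fun n => S (F n)) atTop (nhds (S f)) :=
    (S.continuous.tendsto f).comp (Lp_tendsto_of_ae_of_le hp F f f hle hlim)
  rw [Lp.tendsto_Lp_iff_tendsto_eLpNorm'] at hconv
  have hmeas : TendstoInMeasure μ (fun n => (S (F n) : Ω → ℝ)) atTop (S f) :=
    tendstoInMeasure_of_tendsto_eLpNorm hp0 (fun n => Lp.aestronglyMeasurable _)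
      (Lp.aestronglyMeasurable _)
      hconv
  obtain ⟨ns, hns, hns'⟩ := hmeas.exists_seq_tendsto_ae
  filter_upwards [hSm, hns'] with x h1 h2
  exact ⟨h1, (tendsto_iff_tendsto_subseq_of_monotone h1 hns.tendsto_atTop).2 h2⟩

/-- A positive operator is countably additive along `B ↦ f₀ · 1_B`. -/
theorem IsPositiveOp.ofReal_cut_iUnion (hp : p ≠ ∞) {S : Lp ℝ p μ →L[ℝ] Lp ℝ p μ}
    (hS : IsPositiveOp S) {f₀ : Lp ℝ p μ} (hf₀ : 0 ≤ f₀) (B : ℕ → Set Ω)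
    (hB : ∀ i, MeasurableSet (B i)) (hd : Pairwise (Function.onFun Disjoint B)) :
    ∀ᵐ x ∂μ, ENNReal.ofReal (S (Lp.cut f₀ (⋃ i, B i)) x) =
      ∑' i, ENNReal.ofReal (S (Lp.cut f₀ (B i)) x) := by
  have hsum : ∀ (G : ℕ → Lp ℝ p μ), ∀ᵐ x ∂μ, ∀ n,
      (∑ i ∈ Finset.range n, G i : Lp ℝ p μ) x = ∑ i ∈ Finset.range n, G i x := by
    intro G
    rw [ae_all_iff]
    intro n
    induction n with
    | zero =>
      filter_upwards [Lp.coeFn_zero ℝ p μ] with x hx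
      rw [Finset.sum_range_zero, Finset.sum_range_zero, hx, Pi.zero_apply]
    | succ n ih =>
      rw [Finset.sum_range_succ]
      filter_upwards [ih, Lp.coeFn_add (∑ i ∈ Finset.range n, G i) (G n)] with x h1 h2
      rw [h2, Pi.add_apply, h1, Finset.sum_range_succ]
  have hcut : ∀ᵐ x ∂μ, ∀ i, Lp.cut f₀ (B i) x = (B i).indicator f₀ x :=
    ae_all_iff.2 fun i => Lp.coeFn_cut f₀ (hB i)
  have hnn : ∀ᵐ x ∂μ, ∀ i, 0 ≤ S (Lp.cut f₀ (B i)) x :=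
    ae_all_iff.2 fun i => (Lp.coeFn_nonneg _).2 (hS _ (Lp.cut_nonneg hf₀ _))
  have key := hS.tendsto_ae hp (fun n => ∑ i ∈ Finset.range n, Lp.cut f₀ (B i))
    (Lp.cut f₀ (⋃ i, B i)) (fun n => Finset.sum_nonneg fun i _ => Lp.cut_nonneg hf₀ _)
    (monotone_nat_of_le_succ fun n => by
      rw [Finset.sum_range_succ]
      exact le_add_of_nonneg_right (Lp.cut_nonneg hf₀ _)) (by
      filter_upwards [hsum fun i => Lp.cut f₀ (B i), hcut,
        Lp.coeFn_cut f₀ (MeasurableSet.iUnion hB)] with x h1 h2 h3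
      simp only [h1, h2, h3]
      refine HasSum.tendsto_sum_nat ?_
      by_cases hx : x ∈ ⋃ i, B i
      · obtain ⟨j, hj⟩ := Set.mem_iUnion.1 hx
        rw [Set.indicator_of_mem hx, ← Set.indicator_of_mem hj f₀]
        refine hasSum_single j fun i hi => ?_
        exact Set.indicator_of_notMem (Set.disjoint_left.1 (hd hi.symm) hj) _
      · rw [Set.indicator_of_notMem hx]
        have : ∀ i, (B i).indicator f₀ x = 0 := fun i =>
          Set.indicator_of_notMem (fun h => hx (Set.mem_iUnion.2 ⟨i, h⟩)) _
        simp only [this]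
        exact hasSum_zero)
  filter_upwards [key, hsum fun i => S (Lp.cut f₀ (B i)), hnn] with x h1 h2 h3
  have h4 := ENNReal.tendsto_ofReal h1.2
  simp only [map_sum, h2] at h4
  simp only [fun n => ENNReal.ofReal_sum_of_nonneg (s := Finset.range n) fun i _ => h3 i] at h4
  exact tendsto_nhds_unique h4 (ENNReal.tendsto_nat_tsum _)

/-- A positive operator followed by integration is integration against a measure. -/
theorem IsPositiveOp.exists_measure (hp : p ≠ ∞) {S : Lp ℝ p μ →L[ℝ] Lp ℝ p μ}
    (hS : IsPositiveOp S) {f₀ : Lp ℝ p μ} (hf₀ : ∀ᵐ x ∂μ, 0 < f₀ x) {ρ : Measure Ω}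
    (hρ : ρ ≪ μ) :
    ∃ τ : Measure Ω, τ ≪ μ ∧
      (∀ B, MeasurableSet B → τ B = ∫⁻ x, ENNReal.ofReal (S (Lp.cut f₀ B) x) ∂ρ) ∧
      ∀ g : Lp ℝ p μ, 0 ≤ g →
        ∫⁻ x, ENNReal.ofReal (g x / f₀ x) ∂τ = ∫⁻ x, ENNReal.ofReal (S g x) ∂ρ := by
  have hf₀' : 0 ≤ f₀ := by
    rw [← Lp.coeFn_nonneg]
    filter_upwards [hf₀] with x hx using hx.le
  have hmeas : ∀ g : Lp ℝ p μ, Measurable fun x => ENNReal.ofReal (g x) := fun g =>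
    (Lp.stronglyMeasurable g).measurable.ennreal_ofReal
  have hzero : ∀ g : Lp ℝ p μ, g = 0 → ∫⁻ x, ENNReal.ofReal (S g x) ∂ρ = 0 := by
    rintro g rfl
    rw [map_zero]
    have : ∀ᵐ x ∂ρ, ENNReal.ofReal ((0 : Lp ℝ p μ) x) = 0 := by
      filter_upwards [hρ.ae_le (Lp.coeFn_zero ℝ p μ)] with x hx
      rw [hx, Pi.zero_apply, ENNReal.ofReal_zero]
    rw [lintegral_congr_ae this, lintegral_zero]
  let τ : Measure Ω := Measure.ofMeasurable
    (fun B _ => ∫⁻ x, ENNReal.ofReal (S (Lp.cut f₀ B) x) ∂ρ)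
    (hzero _ (Lp.cut_eq_zero f₀ .empty measure_empty))
    (by
      intro B hB hd
      rw [← lintegral_tsum fun i => (hmeas _).aemeasurable]
      exact lintegral_congr_ae (hρ.ae_le (hS.ofReal_cut_iUnion hp hf₀' B hB hd)))
  have hτ : ∀ B, MeasurableSet B → τ B = ∫⁻ x, ENNReal.ofReal (S (Lp.cut f₀ B) x) ∂ρ :=
    fun B hB => Measure.ofMeasurable_apply B hB
  have hτμ : τ ≪ μ := Measure.AbsolutelyContinuous.mk fun B hB h0 => by
    rw [hτ B hB, hzero _ (Lp.cut_eq_zero f₀ hB h0)]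
  refine ⟨τ, hτμ, hτ, fun g hg => ?_⟩
  have hP : ∀ u : Ω → ℝ≥0∞, Measurable u → Measurable u ∧ ∀ g : Lp ℝ p μ, 0 ≤ g →
      (∀ᵐ x ∂μ, ENNReal.ofReal (g x) = ENNReal.ofReal (f₀ x) * u x) →
      ∫⁻ x, u x ∂τ = ∫⁻ x, ENNReal.ofReal (S g x) ∂ρ := by
    intro u hu
    refine Measurable.ennreal_induction ?_ ?_ ?_ hu
    · intro c B hB
      refine ⟨measurable_const.indicator hB, fun g hg h => ?_⟩
      rw [lintegral_indicator_const hB]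
      by_cases hc : c = ∞
      · have hB0 : μ B = 0 := by
          rw [measure_eq_zero_iff_ae_notMem]
          filter_upwards [h, hf₀] with x h1 h2 h3
          rw [Set.indicator_of_mem h3, hc, ENNReal.mul_top (by simpa using h2)] at h1
          exact ENNReal.ofReal_ne_top h1
        rw [hτμ hB0, mul_zero, hzero]
        apply Lp.ext
        filter_upwards [h, Lp.coeFn_zero ℝ p μ, measure_eq_zero_iff_ae_notMem.1 hB0,
          (Lp.coeFn_nonneg _).2 hg] with x h1 h2 h3 h4
        rw [Set.indicator_of_notMem h3, mul_zero, ENNReal.ofReal_eq_zero] at h1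
        rw [h2]
        exact le_antisymm h1 h4
      · have hgc : g = c.toReal • Lp.cut f₀ B := by
          apply Lp.ext
          filter_upwards [h, Lp.coeFn_smul c.toReal (Lp.cut f₀ B), Lp.coeFn_cut f₀ hB,
            (Lp.coeFn_nonneg _).2 hg, hf₀] with x h1 h2 h3 h4 h5
          rw [h2, Pi.smul_apply, h3, ← ENNReal.toReal_ofReal h4, h1]
          by_cases hx : x ∈ B
          · simp [hx, ENNReal.toReal_ofReal h5.le, mul_comm]
          · simp [hx]
        rw [hgc, map_smul, hτ B hB, ← lintegral_const_mul _ (hmeas _)]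
        refine lintegral_congr_ae (hρ.ae_le ?_)
        filter_upwards [Lp.coeFn_smul c.toReal (S (Lp.cut f₀ B))] with x h1
        rw [h1, Pi.smul_apply, smul_eq_mul, ENNReal.ofReal_mul ENNReal.toReal_nonneg,
          ENNReal.ofReal_toReal hc]
    · intro u v _ hu hv ihu ihv
      refine ⟨hu.add hv, fun g hg h => ?_⟩
      obtain ⟨a, ha0, ha⟩ := Lp.exists_of_le_mul hu (v := u + v) le_self_add h
      obtain ⟨b, hb0, hb⟩ := Lp.exists_of_le_mul hv (v := u + v) le_add_self h
      have hgab : g = a + b := by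
        apply Lp.ext
        filter_upwards [h, ha, hb, (Lp.coeFn_nonneg _).2 hg, (Lp.coeFn_nonneg _).2 ha0,
          (Lp.coeFn_nonneg _).2 hb0, Lp.coeFn_add a b] with x h1 h2 h3 h4 h5 h6 h7
        rw [h7, Pi.add_apply]
        rw [Pi.add_apply, mul_add, ← h2, ← h3, ← ENNReal.ofReal_add h5 h6] at h1
        exact (ENNReal.ofReal_eq_ofReal_iff h4 (add_nonneg h5 h6)).1 h1
      simp only [Pi.add_apply]
      rw [lintegral_add_left hu, ihu.2 a ha0 ha, ihv.2 b hb0 hb, hgab, map_add,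
        ← lintegral_add_left (hmeas _)]
      refine lintegral_congr_ae (hρ.ae_le ?_)
      filter_upwards [Lp.coeFn_add (S a) (S b), (Lp.coeFn_nonneg _).2 (hS _ ha0),
        (Lp.coeFn_nonneg _).2 (hS _ hb0)] with x h1 h2 h3
      rw [h1, Pi.add_apply, ENNReal.ofReal_add h2 h3]
    · intro u hu hmono ih
      refine ⟨Measurable.iSup hu, fun g hg h => ?_⟩
      choose a ha0 ha using fun n => Lp.exists_of_le_mul (hu n)
        (v := fun x => ⨆ n, u n x) (fun x => le_iSup (fun n => u n x) n) h
      have hae : ∀ᵐ x ∂μ, ∀ n, ENNReal.ofReal (a n x) = ENNReal.ofReal (f₀ x) * u n x :=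
        ae_all_iff.2 ha
      have hae0 : ∀ᵐ x ∂μ, ∀ n, 0 ≤ a n x := ae_all_iff.2 fun n => (Lp.coeFn_nonneg _).2 (ha0 n)
      have hamono : Monotone a := fun i j hij => by
        rw [← Lp.coeFn_le]
        filter_upwards [hae, hae0] with x h1 h2
        rw [← ENNReal.ofReal_le_ofReal_iff (h2 j), h1, h1]
        gcongr
        exact hmono hij x
      have hconv := hS.tendsto_ae hp a g ha0 hamono (by
        filter_upwards [hae, hae0, h, (Lp.coeFn_nonneg _).2 hg] with x h1 h2 h3 h4
        have h5 : Tendsto (fun n => ENNReal.ofReal (a n x)) atTop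
            (nhds (ENNReal.ofReal (g x))) := by
          simp only [h1, h3]
          rw [ENNReal.mul_iSup]
          exact tendsto_atTop_iSup fun i j hij => mul_le_mul_right (hmono hij x) _
        have h6 := (ENNReal.tendsto_toReal ENNReal.ofReal_ne_top).comp h5
        rw [ENNReal.toReal_ofReal h4] at h6
        refine h6.congr fun n => ?_
        exact ENNReal.toReal_ofReal (h2 n))
      rw [lintegral_iSup hu hmono]
      simp only [fun n => (ih n).2 (a n) (ha0 n) (ha n)]
      rw [← lintegral_iSup_ae (fun n => hmeas _)]
      · refine lintegral_congr_ae (hρ.ae_le ?_)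
        filter_upwards [hconv] with x hx
        refine tendsto_nhds_unique (tendsto_atTop_iSup fun i j hij => ?_)
          (ENNReal.tendsto_ofReal hx.2)
        exact ENNReal.ofReal_le_ofReal (hx.1 hij)
      · intro n
        refine hρ.ae_le ?_
        filter_upwards [hconv] with x hx
        exact ENNReal.ofReal_le_ofReal (hx.1 n.le_succ)
  refine (hP _ ?_).2 g hg ?_
  · exact ((Lp.stronglyMeasurable g).measurable.div
      (Lp.stronglyMeasurable f₀).measurable).ennreal_ofReal
  · filter_upwards [hf₀] with x hx
    have hx0 := hx.ne'
    rw [← ENNReal.ofReal_mul hx.le, mul_div_cancel₀ _ hx0]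

/-- An operator represented by an s-finite measure on the product, absolutely continuous with
respect to the product measure, is an integral operator. -/
theorem isIntegralOp_of_measure [SigmaFinite μ] {m : Measure Ω} [IsFiniteMeasure m]
    (hμm : μ ≪ m) {S : Lp ℝ p μ →L[ℝ] Lp ℝ p μ} {f₀ : Lp ℝ p μ}
    (hf₀ : ∀ᵐ x ∂μ, 0 < f₀ x) (hS : IsPositiveOp S) (ν : Measure (Ω × Ω)) [SFinite ν]
    (hν : ν ≪ μ.prod m)
    (h : ∀ f : Lp ℝ p μ, 0 ≤ f → ∀ C, MeasurableSet C →
      ∫⁻ z, ENNReal.ofReal (f z.1) * C.indicator 1 z.2 ∂ν =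
        ∫⁻ y in C, ENNReal.ofReal (S f y) ∂m) :
    IsIntegralOp S := by
  have hmeas : ∀ g : Lp ℝ p μ, Measurable fun x => ENNReal.ofReal (g x) := fun g =>
    (Lp.stronglyMeasurable g).measurable.ennreal_ofReal
  have hf₀' : 0 ≤ f₀ := by
    rw [← Lp.coeFn_nonneg]
    filter_upwards [hf₀] with x hx using hx.le
  set d : Ω × Ω → ℝ≥0∞ := ν.rnDeriv (μ.prod m) with hd
  have hdm : Measurable d := Measure.measurable_rnDeriv _ _
  have hG : ∀ f : Lp ℝ p μ, 0 ≤ f →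
      ∀ᵐ y ∂μ, ∫⁻ x, d (x, y) * ENNReal.ofReal (f x) ∂μ = ENNReal.ofReal (S f y) := by
    intro f hf
    refine hμm.ae_le ?_
    have hint : Measurable fun y => ∫⁻ x, d (x, y) * ENNReal.ofReal (f x) ∂μ :=
      Measurable.lintegral_prod_left' (f := fun z : Ω × Ω => d z * ENNReal.ofReal (f z.1))
        (hdm.mul ((hmeas f).comp measurable_fst))
    refine ae_eq_of_forall_setLIntegral_eq_of_sigmaFinite hint (hmeas _) fun C hC _ => ?_
    have h1m : Measurable (C.indicator (1 : Ω → ℝ≥0∞)) := measurable_one.indicator hC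
    have hg : Measurable fun z : Ω × Ω => ENNReal.ofReal (f z.1) * C.indicator 1 z.2 :=
      ((hmeas f).comp measurable_fst).mul (h1m.comp measurable_snd)
    rw [← h f hf C hC, ← Measure.withDensity_rnDeriv_eq ν (μ.prod m) hν,
      lintegral_withDensity_eq_lintegral_mul _ hdm hg,
      lintegral_prod_symm _ (hdm.mul hg).aemeasurable,
      ← lintegral_indicator hC]
    refine lintegral_congr fun y => ?_
    by_cases hy : y ∈ C <;> simp [hy, hd]
  have hdfin : ∀ᵐ y ∂μ, ∀ᵐ x ∂μ, d (x, y) ≠ ∞ := by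
    filter_upwards [hG f₀ hf₀'] with y hy
    have hfin : ∫⁻ x, d (x, y) * ENNReal.ofReal (f₀ x) ∂μ ≠ ∞ := by
      rw [hy]; exact ENNReal.ofReal_ne_top
    filter_upwards [ae_lt_top ((hdm.comp measurable_prodMk_right).mul (hmeas f₀)) hfin, hf₀]
      with x h1 h2 h3
    have : d (x, y) * ENNReal.ofReal (f₀ x) < ∞ := h1
    rw [h3, ENNReal.top_mul (by simpa using h2)] at this
    exact lt_irrefl _ this
  have hnn : ∀ f : Lp ℝ p μ, 0 ≤ f → ∀ᵐ y ∂μ,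
      Integrable (fun x => (d (x, y)).toReal * f x) μ ∧
        S f y = ∫ x, (d (x, y)).toReal * f x ∂μ := by
    intro f hf
    filter_upwards [hG f hf, hdfin, (Lp.coeFn_nonneg _).2 (hS f hf)] with y h1 h2 h3
    have hm : AEStronglyMeasurable (fun x => (d (x, y)).toReal * f x) μ :=
      ((hdm.comp measurable_prodMk_right).ennreal_toReal.mul
        (Lp.stronglyMeasurable f).measurable).aestronglyMeasurable
    have h0 : 0 ≤ᵐ[μ] fun x => (d (x, y)).toReal * f x := by
      filter_upwards [(Lp.coeFn_nonneg _).2 hf] with x hx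
      exact mul_nonneg ENNReal.toReal_nonneg hx
    have h4 : ∫⁻ x, ENNReal.ofReal ((d (x, y)).toReal * f x) ∂μ = ENNReal.ofReal (S f y) := by
      rw [← h1]
      refine lintegral_congr_ae ?_
      filter_upwards [h2] with x hx
      rw [ENNReal.ofReal_mul ENNReal.toReal_nonneg, ENNReal.ofReal_toReal hx]
    refine ⟨⟨hm, ?_⟩, ?_⟩
    · rw [hasFiniteIntegral_iff_ofReal h0, h4]
      exact ENNReal.ofReal_lt_top
    · rw [integral_eq_lintegral_of_nonneg_ae h0 hm, h4, ENNReal.toReal_ofReal h3]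
  refine ⟨fun x y => (d (x, y)).toReal, hdm.ennreal_toReal, fun _ _ => ENNReal.toReal_nonneg,
    fun f => ?_⟩
  have h1 := hnn |f| (abs_nonneg f)
  have h2 := hnn (|f| - f) (sub_nonneg.2 (le_abs_self f))
  have hf : ∀ᵐ x ∂μ, f x = |f| x - (|f| - f : Lp ℝ p μ) x := by
    filter_upwards [Lp.coeFn_sub |f| f] with x hx
    rw [hx, Pi.sub_apply]; ring
  have hSf : ∀ᵐ x ∂μ, S f x = S |f| x - S (|f| - f) x := by
    have : S f = S |f| - S (|f| - f) := by rw [← map_sub]; congr 1; abel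
    rw [this]
    exact Lp.coeFn_sub _ _
  have heq : ∀ y, (fun x => (d (x, y)).toReal * f x) =ᵐ[μ] fun x =>
      (d (x, y)).toReal * |f| x - (d (x, y)).toReal * (|f| - f : Lp ℝ p μ) x := by
    intro y
    filter_upwards [hf] with x hx
    rw [hx]; ring
  constructor
  · filter_upwards [h1, h2] with y h1 h2
    exact (h1.1.sub h2.1).congr (heq y).symm
  · filter_upwards [h1, h2, hSf] with y h1 h2 h3
    rw [h3, h1.2, h2.2, integral_congr_ae (heq y), integral_sub h1.1 h2.1]

theorem IsIntegralOp.add {S T : Lp ℝ p μ →L[ℝ] Lp ℝ p μ} (hS : IsIntegralOp S)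
    (hT : IsIntegralOp T) : IsIntegralOp (S + T) := by
  obtain ⟨k, hk, hk0, h⟩ := hS
  obtain ⟨l, hl, hl0, h'⟩ := hT
  refine ⟨fun x y => k x y + l x y, hk.add hl, fun x y => add_nonneg (hk0 x y) (hl0 x y),
    fun f => ⟨?_, ?_⟩⟩
  · filter_upwards [(h f).1, (h' f).1] with y h1 h2
    exact (h1.add h2).congr (Eventually.of_forall fun x => (add_mul _ _ _).symm)
  · filter_upwards [(h f).1, (h' f).1, (h f).2, (h' f).2, Lp.coeFn_add (S f) (T f)]
      with y h1 h2 h3 h4 h5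
    rw [_root_.add_apply, h5, Pi.add_apply, h3, h4, ← integral_add h1 h2]
    simp only [add_mul]

/-- The bimeasure `(A, C) ↦ ∫_C T (f₀ 1_A) dm` of a positive operator `T`, through its families of
marginals. -/
theorem IsPositiveOp.exists_bimeasure [SigmaFinite μ] (hp : p ≠ ∞)
    {T : Lp ℝ p μ →L[ℝ] Lp ℝ p μ} (hT : IsPositiveOp T) {f₀ : Lp ℝ p μ}
    (hf₀ : ∀ᵐ x ∂μ, 0 < f₀ x) :
    ∃ (q : Ω → ℝ≥0∞) (τ σ : Set Ω → Measure Ω), Measurable q ∧ (∀ x, q x ≠ 0) ∧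
      (∀ x, q x ≠ ∞) ∧ IsFiniteMeasure (μ.withDensity q) ∧
      (∀ A C, MeasurableSet A → MeasurableSet C → τ C A = σ A C) ∧
      τ Set.univ Set.univ ≠ ∞ ∧ (∀ C, τ C ≪ μ) ∧
      (∀ A, σ A = (μ.withDensity q).withDensity
        fun z => ENNReal.ofReal (T (Lp.cut f₀ A) z)) ∧
      ∀ C (g : Lp ℝ p μ), 0 ≤ g → ∫⁻ x, ENNReal.ofReal (g x / f₀ x) ∂(τ C) =
        ∫⁻ x in C, ENNReal.ofReal (T g x) ∂(μ.withDensity q) := by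
  obtain ⟨q, hq, hq0, hqt, hqi, hqT⟩ := exists_weight_s10 (T (Lp.cut f₀ Set.univ))
  have hac : ∀ C, (μ.withDensity q).restrict C ≪ μ := fun C =>
    Measure.restrict_le_self.absolutelyContinuous.trans (withDensity_absolutelyContinuous _ _)
  choose τ hτμ hτ hτg using fun C => hT.exists_measure hp hf₀ (hac C)
  refine ⟨q, τ, fun A => (μ.withDensity q).withDensity
    fun z => ENNReal.ofReal (T (Lp.cut f₀ A) z), hq, hq0, hqt,
    isFiniteMeasure_withDensity hqi, ?_, ?_, hτμ, fun A => rfl, hτg⟩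
  · intro A C hA hC
    rw [hτ C A hA, withDensity_apply _ hC]
  · rw [hτ _ _ .univ, Measure.restrict_univ]
    exact hqT

/-- A positive operator composed with a positive integral operator is an integral operator. -/
theorem IsIntegralOp.comp_left [SigmaFinite μ] (hp : p ≠ ∞) {K T : Lp ℝ p μ →L[ℝ] Lp ℝ p μ}
    (hK : IsIntegralOp K) (hKpos : IsPositiveOp K) (hT : IsPositiveOp T) {f₀ : Lp ℝ p μ}
    (hf₀ : ∀ᵐ x ∂μ, 0 < f₀ x) : IsIntegralOp (T.comp K) := by
  obtain ⟨q, τ, σ, hq, hq0, hqt, hfin, hsymm, hτfin, hτμ, hσ, hτg⟩ := hT.exists_bimeasure hp hf₀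
  set m := μ.withDensity q
  have hμm : μ ≪ m := withDensity_absolutelyContinuous' hq.aemeasurable (by simp [hq0])
  obtain ⟨k, hk, hk0, hkK⟩ := hK
  have hmeas : ∀ g : Lp ℝ p μ, Measurable fun x => ENNReal.ofReal (g x) := fun g =>
    (Lp.stronglyMeasurable g).measurable.ennreal_ofReal
  have hhm : Measurable (Function.uncurry fun x z => ENNReal.ofReal (k x z / f₀ z)) :=
    (hk.div ((Lp.stronglyMeasurable f₀).measurable.comp measurable_snd)).ennreal_ofReal
  obtain ⟨κ, _, hκ⟩ := exists_kernel_of_bimeasure τ σ hsymm hτfin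
    (fun x z => ENNReal.ofReal (k x z / f₀ z)) hhm fun _ _ => ENNReal.ofReal_ne_top
  have hκm : ∀ x, κ x ≪ m := fun x => Measure.AbsolutelyContinuous.mk fun C hC h0 => by
    have : τ C = 0 := by
      rw [← Measure.measure_univ_eq_zero, hsymm _ _ .univ hC, hσ]
      exact withDensity_absolutelyContinuous _ _ h0
    rw [hκ x C hC, this, lintegral_zero_measure]
  refine isIntegralOp_of_measure hμm hf₀ (fun f hf => hT _ (hKpos f hf)) (μ ⊗ₘ κ) ?_ ?_
  · rw [← Measure.compProd_const]
    exact Measure.AbsolutelyContinuous.compProd_right (Eventually.of_forall hκm)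
  · intro f hf C hC
    have h1m : Measurable (C.indicator (1 : Ω → ℝ≥0∞)) := measurable_one.indicator hC
    have hτC : IsFiniteMeasure (τ C) := ⟨by
      rw [hsymm _ _ .univ hC]
      refine lt_of_le_of_lt (measure_mono (Set.subset_univ C)) ?_
      rw [← hsymm _ _ .univ .univ]
      exact hτfin.lt_top⟩
    calc ∫⁻ z, ENNReal.ofReal (f z.1) * C.indicator 1 z.2 ∂(μ ⊗ₘ κ)
        = ∫⁻ x, ∫⁻ y, ENNReal.ofReal (f x) * C.indicator 1 y ∂(κ x) ∂μ :=
          Measure.lintegral_compProd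
            (((hmeas f).comp measurable_fst).mul (h1m.comp measurable_snd))
      _ = ∫⁻ x, ∫⁻ z, ENNReal.ofReal (f x) * ENNReal.ofReal (k x z / f₀ z) ∂(τ C) ∂μ := by
          refine lintegral_congr fun x => ?_
          rw [lintegral_const_mul _ h1m, lintegral_indicator_one hC, hκ x C hC,
            lintegral_const_mul _ (Measurable.of_uncurry_left hhm)]
      _ = ∫⁻ z, ∫⁻ x, ENNReal.ofReal (f x) * ENNReal.ofReal (k x z / f₀ z) ∂μ ∂(τ C) :=
          lintegral_lintegral_swap
            (((hmeas f).comp measurable_fst).mul hhm).aemeasurable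
      _ = ∫⁻ z, ENNReal.ofReal (K f z / f₀ z) ∂(τ C) := by
          refine lintegral_congr_ae ((hτμ C).ae_le ?_)
          filter_upwards [(hkK f).1, (hkK f).2, hf₀] with z h1 h2 h3
          have h0 : 0 ≤ᵐ[μ] fun x => k x z * f x := by
            filter_upwards [(Lp.coeFn_nonneg _).2 hf] with x hx
            exact mul_nonneg (hk0 x z) hx
          rw [h2, div_eq_mul_inv, mul_comm, ENNReal.ofReal_mul (inv_nonneg.2 h3.le),
            ofReal_integral_eq_lintegral_ofReal h1 h0, ← lintegral_const_mul']
          · refine lintegral_congr fun x => ?_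
            rw [mul_comm, ← ENNReal.ofReal_mul (div_nonneg (hk0 x z) h3.le),
              ← ENNReal.ofReal_mul (inv_nonneg.2 h3.le)]
            congr 1
            ring
          · exact ENNReal.ofReal_ne_top
      _ = ∫⁻ y in C, ENNReal.ofReal (T.comp K f y) ∂m := hτg C _ (hKpos f hf)

/-- A positive integral operator composed with a positive operator is an integral operator. -/
theorem IsIntegralOp.comp_right [SigmaFinite μ] (hp : p ≠ ∞) {K T : Lp ℝ p μ →L[ℝ] Lp ℝ p μ}
    (hK : IsIntegralOp K) (hKpos : IsPositiveOp K) (hT : IsPositiveOp T) {f₀ : Lp ℝ p μ}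
    (hf₀ : ∀ᵐ x ∂μ, 0 < f₀ x) : IsIntegralOp (K.comp T) := by
  obtain ⟨q, τ, σ, hq, hq0, hqt, hfin, hsymm, hτfin, hτμ, hσ, hτg⟩ := hT.exists_bimeasure hp hf₀
  set m := μ.withDensity q
  have hμm : μ ≪ m := withDensity_absolutelyContinuous' hq.aemeasurable (by simp [hq0])
  have hmμ : m ≪ μ := withDensity_absolutelyContinuous _ _
  obtain ⟨k, hk, hk0, hkK⟩ := hK
  have hKT : IsPositiveOp (K.comp T) := fun f hf => hKpos _ (hT f hf)
  have hf₀' : 0 ≤ f₀ := by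
    rw [← Lp.coeFn_nonneg]
    filter_upwards [hf₀] with x hx using hx.le
  have hmeas : ∀ g : Lp ℝ p μ, Measurable fun x => ENNReal.ofReal (g x) := fun g =>
    (Lp.stronglyMeasurable g).measurable.ennreal_ofReal
  have hhm : Measurable (Function.uncurry fun y z => ENNReal.ofReal (k z y) / q z) :=
    (hk.comp measurable_swap).ennreal_ofReal.div (hq.comp measurable_snd)
  obtain ⟨κ, _, hκ⟩ := exists_kernel_of_bimeasure σ τ (fun A C hA hC => (hsymm C A hC hA).symm)
    (by rwa [← hsymm _ _ .univ .univ]) _ hhm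
    fun y z => ENNReal.div_ne_top ENNReal.ofReal_ne_top (hq0 z)
  have hκμ : ∀ y, κ y ≪ μ := fun y => Measure.AbsolutelyContinuous.mk fun A hA h0 => by
    have : σ A = 0 := by
      rw [← Measure.measure_univ_eq_zero, ← hsymm _ _ hA .univ]
      exact hτμ _ h0
    rw [hκ y A hA, this, lintegral_zero_measure]
  have hκK : ∀ A, MeasurableSet A →
      ∀ᵐ y ∂μ, κ y A = ENNReal.ofReal (K (T (Lp.cut f₀ A)) y) := by
    intro A hA
    have hpos := hT _ (Lp.cut_nonneg hf₀' A)
    filter_upwards [(hkK (T (Lp.cut f₀ A))).1, (hkK (T (Lp.cut f₀ A))).2] with y h1 h2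
    have h0 : 0 ≤ᵐ[μ] fun x => k x y * T (Lp.cut f₀ A) x := by
      filter_upwards [(Lp.coeFn_nonneg _).2 hpos] with x hx
      exact mul_nonneg (hk0 x y) hx
    have hhy : Measurable fun z => ENNReal.ofReal (k z y) / q z := Measurable.of_uncurry_left hhm
    rw [hκ y A hA, hσ, h2, ofReal_integral_eq_lintegral_ofReal h1 h0,
      lintegral_withDensity_eq_lintegral_mul _ (hmeas _) hhy,
      lintegral_withDensity_eq_lintegral_mul _ hq ((hmeas _).mul hhy)]
    refine lintegral_congr fun z => ?_
    simp only [Pi.mul_apply]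
    rw [ENNReal.ofReal_mul (hk0 z y), mul_left_comm, ENNReal.mul_div_cancel (hq0 z) (hqt z),
      mul_comm]
  have hinv : Measurable fun x => ENNReal.ofReal (|f₀ x|⁻¹) :=
    (Lp.stronglyMeasurable f₀).measurable.abs.inv.ennreal_ofReal
  refine isIntegralOp_of_measure hμm hf₀ hKT
    (((m ⊗ₘ κ).map Prod.swap).withDensity fun z => ENNReal.ofReal (|f₀ z.1|⁻¹)) ?_ ?_
  · refine (withDensity_absolutelyContinuous _ _).trans ?_
    rw [← Measure.prod_swap, ← Measure.compProd_const]
    exact (Measure.AbsolutelyContinuous.compProd_right (Eventually.of_forall hκμ)).map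
      measurable_swap
  · intro f hf C hC
    obtain ⟨τ', hτ'μ, hτ', hgτ⟩ := hKT.exists_measure hp hf₀
      (Measure.restrict_le_self.absolutelyContinuous.trans hmμ : m.restrict C ≪ μ)
    have hbind : τ' = (m.restrict C).bind κ := by
      ext A hA
      rw [hτ' A hA, Measure.bind_apply hA κ.measurable.aemeasurable]
      refine lintegral_congr_ae ?_
      filter_upwards [(Measure.restrict_le_self.absolutelyContinuous.trans hmμ :
        m.restrict C ≪ μ).ae_le (hκK A hA)] with y hy
      exact hy.symm
    have h1m : Measurable (C.indicator (1 : Ω → ℝ≥0∞)) := measurable_one.indicator hC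
    have hu : Measurable fun x => ENNReal.ofReal (|f₀ x|⁻¹) * ENNReal.ofReal (f x) :=
      hinv.mul (hmeas f)
    have hg1 : Measurable fun z : Ω × Ω => ENNReal.ofReal (f z.1) * C.indicator 1 z.2 :=
      ((hmeas f).comp measurable_fst).mul (h1m.comp measurable_snd)
    have hg2 : Measurable fun z : Ω × Ω => ENNReal.ofReal (|f₀ z.1|⁻¹) :=
      hinv.comp measurable_fst
    rw [lintegral_withDensity_eq_lintegral_mul _ hg2 hg1,
      lintegral_map (hg2.mul hg1) measurable_swap]
    calc _ = ∫⁻ y, ∫⁻ x, ENNReal.ofReal (|f₀ x|⁻¹) *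
            (ENNReal.ofReal (f x) * C.indicator 1 y) ∂(κ y) ∂m :=
          Measure.lintegral_compProd ((hg2.mul hg1).comp measurable_swap)
      _ = ∫⁻ y in C, ∫⁻ x, ENNReal.ofReal (|f₀ x|⁻¹) * ENNReal.ofReal (f x) ∂(κ y) ∂m := by
          rw [← lintegral_indicator hC]
          refine lintegral_congr fun y => ?_
          by_cases hy : y ∈ C <;> simp [hy]
      _ = ∫⁻ x, ENNReal.ofReal (|f₀ x|⁻¹) * ENNReal.ofReal (f x) ∂τ' := by
          rw [hbind, Measure.lintegral_bind κ.measurable.aemeasurable hu.aemeasurable]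
      _ = ∫⁻ x, ENNReal.ofReal (f x / f₀ x) ∂τ' := by
          refine lintegral_congr_ae (hτ'μ.ae_le ?_)
          filter_upwards [hf₀] with x hx
          rw [abs_of_pos hx, ← ENNReal.ofReal_mul (inv_nonneg.2 hx.le), div_eq_inv_mul]
      _ = ∫⁻ y in C, ENNReal.ofReal (K.comp T f y) ∂m := hgτ f hf

/-- The `L^p`-norm is strictly monotone on the positive cone. -/
theorem Lp.eq_of_le_of_norm_le (hp : p ≠ ∞) {f g : Lp ℝ p μ} (hf : 0 ≤ f) (hfg : f ≤ g)
    (hn : ‖g‖ ≤ ‖f‖) : f = g := by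
  have hp0 : p ≠ 0 := (lt_of_lt_of_le one_pos (Fact.out : 1 ≤ p)).ne'
  have hpr : 0 < p.toReal := ENNReal.toReal_pos hp0 hp
  have hle : ∀ᵐ x ∂μ, ‖f x‖ₑ ^ p.toReal ≤ ‖g x‖ₑ ^ p.toReal := by
    filter_upwards [(Lp.coeFn_le _ _).2 hfg, (Lp.coeFn_nonneg _).2 hf] with x h1 h2
    have h3 : (0 : ℝ) ≤ f x := h2
    gcongr
    rw [enorm_le_iff_norm_le, Real.norm_of_nonneg h3, Real.norm_of_nonneg (h3.trans h1)]
    exact h1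
  have hn' : eLpNorm g p μ ≤ eLpNorm f p μ := by
    rwa [Lp.norm_def, Lp.norm_def, ENNReal.toReal_le_toReal (Lp.eLpNorm_ne_top _)
      (Lp.eLpNorm_ne_top _)] at hn
  rw [eLpNorm_eq_lintegral_rpow_enorm_toReal hp0 hp,
    eLpNorm_eq_lintegral_rpow_enorm_toReal hp0 hp,
    ENNReal.rpow_le_rpow_iff (by positivity)] at hn'
  have hfin := (lintegral_rpow_enorm_lt_top_of_eLpNorm_lt_top hp0 hp (Lp.eLpNorm_lt_top f)).ne
  have heq := ae_eq_of_ae_le_of_lintegral_le hle hfin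
    ((Lp.aestronglyMeasurable g).enorm.pow_const _) hn'
  apply Lp.ext
  filter_upwards [heq, (Lp.coeFn_le _ _).2 hfg, (Lp.coeFn_nonneg _).2 hf] with x h1 h2 h3
  have h3' : (0 : ℝ) ≤ f x := h3
  have h4 := (ENNReal.rpow_left_injective hpr.ne') h1
  rwa [enorm_eq_iff_norm_eq, Real.norm_of_nonneg h3', Real.norm_of_nonneg (h3'.trans h2)] at h4

/-- A decreasing sequence in the positive cone of `L^p` converges in norm. -/
theorem Lp.exists_tendsto_of_antitone (hp : p ≠ ∞) (F : ℕ → Lp ℝ p μ) (h0 : ∀ n, 0 ≤ F n)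
    (hF : Antitone F) : ∃ f : Lp ℝ p μ, Tendsto F atTop (nhds f) := by
  have hm : ∀ᵐ x ∂μ, Antitone fun n => F n x := by
    have : ∀ᵐ x ∂μ, ∀ n, F (n + 1) x ≤ F n x :=
      ae_all_iff.2 fun n => (Lp.coeFn_le _ _).2 (hF n.le_succ)
    filter_upwards [this] with x hx using antitone_nat_of_succ_le hx
  have hnn : ∀ᵐ x ∂μ, ∀ n, 0 ≤ F n x := ae_all_iff.2 fun n => (Lp.coeFn_nonneg _).2 (h0 n)
  have hlim : ∀ᵐ x ∂μ, Tendsto (fun n => F n x) atTop (nhds (⨅ n, F n x)) := by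
    filter_upwards [hm, hnn] with x h1 h2
    exact tendsto_atTop_ciInf h1 ⟨0, by rintro _ ⟨n, rfl⟩; exact h2 n⟩
  have hmem : MemLp (fun x => ⨅ n, F n x) p μ := by
    refine (Lp.memLp (F 0)).of_le ?_ ?_
    · exact aestronglyMeasurable_of_tendsto_ae atTop (fun n => Lp.aestronglyMeasurable _) hlim
    · filter_upwards [hnn, hm, hlim] with x h1 h2 h3
      rw [Real.norm_of_nonneg (Real.iInf_nonneg h1), Real.norm_of_nonneg (h1 0)]
      exact h2.le_of_tendsto h3 0
  refine ⟨hmem.toLp, Lp_tendsto_of_ae_of_le hp F _ (F 0) (fun n => ?_) ?_⟩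
  · rw [abs_of_nonneg (h0 n)]
    exact hF n.zero_le
  · filter_upwards [hlim, hmem.coeFn_toLp] with x h1 h2
    rwa [h2]

end

/-- Under condition (*), the remainder `R t f₀ = (T t - K t) f₀` of the strictly positive
fixed point `f₀` tends to `0` in norm as `t → ∞`. -/
theorem remainder_of_fixedPoint_tendsto_zero
    {Ω : Type*} [MeasurableSpace Ω] (μ : Measure Ω) [SigmaFinite μ]
    (p : ℝ≥0∞) [Fact (1 ≤ p)] (hp : p ≠ ∞)
    (T : ℝ≥0 → (Lp ℝ p μ →L[ℝ] Lp ℝ p μ))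
    (hpos : ∀ t, IsPositiveOp (T t))
    (hcontr : ∀ t (f : Lp ℝ p μ), ‖T t f‖ ≤ ‖f‖)
    (hT0 : T 0 = ContinuousLinearMap.id ℝ (Lp ℝ p μ))
    (hsem : ∀ s t, T (s + t) = (T s).comp (T t))
    (hcont : ∀ f : Lp ℝ p μ, Continuous fun t => T t f)
    (f₀ : Lp ℝ p μ) (hfix : ∀ t, T t f₀ = f₀)
    (hf₀pos : ∀ᵐ x ∂μ, 0 < f₀ x)
    (hstar : ∀ f : Lp ℝ p μ, 0 ≤ f → f ≠ 0 → (∀ t, T t f = f) →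
      ∃ (t : ℝ≥0) (K' : Lp ℝ p μ →L[ℝ] Lp ℝ p μ), IsPositiveOp K' ∧ IsIntegralOp K' ∧
        (∀ g : Lp ℝ p μ, 0 ≤ g → K' g ≤ T t g) ∧ K' f ≠ 0)
    (K : ℝ≥0 → (Lp ℝ p μ →L[ℝ] Lp ℝ p μ))
    (hKpos : ∀ t, IsPositiveOp (K t))
    (hKker : ∀ t, IsIntegralOp (K t))
    (hKdom : ∀ t, ∀ f : Lp ℝ p μ, 0 ≤ f → K t f ≤ T t f)
    (hKmax : ∀ t, ∀ K' : Lp ℝ p μ →L[ℝ] Lp ℝ p μ, IsPositiveOp K' → IsIntegralOp K' →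
      (∀ f : Lp ℝ p μ, 0 ≤ f → K' f ≤ T t f) → ∀ f : Lp ℝ p μ, 0 ≤ f → K' f ≤ K t f) :
    Tendsto (fun t => ‖(T t - K t) f₀‖) atTop (nhds 0) := by
  have hf₀0 : 0 ≤ f₀ := by
    rw [← Lp.coeFn_nonneg]
    filter_upwards [hf₀pos] with x hx using hx.le
  have hRpos : ∀ t, IsPositiveOp (T t - K t) := fun t f hf => by
    rw [_root_.sub_apply, sub_nonneg]
    exact hKdom t f hf
  have hR : ∀ s t f, 0 ≤ f → (T (s + t) - K (s + t)) f ≤ (T s - K s) ((T t - K t) f) := by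
    intro s t f hf
    have hpos1 : IsPositiveOp ((K s).comp (T t)) := fun g hg => hKpos s _ (hpos t g hg)
    have hpos2 : IsPositiveOp ((T s - K s).comp (K t)) := fun g hg =>
      hRpos s _ (hKpos t g hg)
    have hmax := hKmax (s + t) ((K s).comp (T t) + (T s - K s).comp (K t))
      (fun g hg => by
        rw [_root_.add_apply]
        exact add_nonneg (hpos1 g hg) (hpos2 g hg))
      (((hKker s).comp_right hp (hKpos s) (hpos t) hf₀pos).add
        ((hKker t).comp_left hp (hKpos t) (hRpos s) hf₀pos))
      (fun g hg => by
        have := hRpos s _ (hRpos t g hg)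
        rw [hsem, ← sub_nonneg]
        convert this using 1
        simp only [_root_.sub_apply, _root_.add_apply, ContinuousLinearMap.comp_apply, map_sub]
        abel) f hf
    rw [← sub_nonneg] at hmax ⊢
    convert hmax using 1
    simp only [_root_.sub_apply, _root_.add_apply, ContinuousLinearMap.comp_apply, map_sub, hsem]
    abel
  set r : ℝ≥0 → Lp ℝ p μ := fun t => (T t - K t) f₀ with hr
  have hr0 : ∀ t, 0 ≤ r t := fun t => hRpos t f₀ hf₀0
  have hle : ∀ t, r t ≤ f₀ := fun t => by
    simp only [hr, _root_.sub_apply, hfix]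
    exact sub_le_self _ (hKpos t f₀ hf₀0)
  have hanti : Antitone r := fun s t hst => by
    obtain ⟨u, rfl⟩ := exists_add_of_le hst
    exact (hR s u f₀ hf₀0).trans ((hRpos s).mono (hle u))
  obtain ⟨f, hf⟩ := Lp.exists_tendsto_of_antitone hp (fun n : ℕ => r n) (fun n => hr0 n)
    (fun i j hij => hanti (by exact_mod_cast hij))
  have hfr : ∀ t, f ≤ r t := fun t => by
    obtain ⟨n, hn⟩ := exists_nat_ge t
    refine le_of_tendsto hf ?_
    filter_upwards [eventually_ge_atTop n] with k hk
    exact hanti (hn.trans (by exact_mod_cast hk))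
  have hf0 : 0 ≤ f := ge_of_tendsto' hf fun n => hr0 n
  have hfR : ∀ s, f ≤ (T s - K s) f := fun s =>
    ge_of_tendsto' (((T s - K s).continuous.tendsto f).comp hf) fun n =>
      (hfr (s + n)).trans (hR s n f₀ hf₀0)
  have hfT : ∀ s, T s f = f := fun s => by
    refine (Lp.eq_of_le_of_norm_le hp hf0 ((hfR s).trans ?_) (hcontr s f)).symm
    rw [_root_.sub_apply]
    exact sub_le_self _ (hKpos s f hf0)
  have hKf : ∀ s, K s f ≤ 0 := fun s => by
    have := hfR s
    rw [_root_.sub_apply, hfT] at this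
    simpa using this
  have hzero : f = 0 := by
    by_contra hne
    obtain ⟨t, K', hK'pos, hK'ker, hK'dom, hK'f⟩ := hstar f hf0 hne hfT
    exact hK'f (le_antisymm ((hKmax t K' hK'pos hK'ker hK'dom f hf0).trans (hKf t))
      (hK'pos f hf0))
  have hnorm : Tendsto (fun n : ℕ => ‖r n‖) atTop (nhds 0) := by
    simpa [hzero] using hf.norm
  have hfloor : Tendsto (fun t : ℝ≥0 => ‖r (⌊t⌋₊ : ℕ)‖) atTop (nhds 0) :=
    hnorm.comp tendsto_nat_floor_atTop
  refine squeeze_zero (fun t => norm_nonneg _) (fun t => ?_) hfloor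
  have h1 : r t ≤ r (⌊t⌋₊ : ℕ) := hanti (Nat.floor_le zero_le)
  refine HasSolidNorm.solid ?_
  rwa [abs_of_nonneg (hr0 _), abs_of_nonneg (hr0 _)]
end
end
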